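/- arXiv:2211.13456 — 2 statements merged into one kernel-verified Lean document; each statement's English description precedes it below -/
import Mathlib

section
/- Let W ⊆ V⊗ℝ^ℓ be a geometric non-local space and let φ: W → V be a canceling linear operator. Then the bilinear trace inequality holds at the endpoint α = −κ′(1)/log m: there exists a constant C (depending only on m, ℓ, W, φ) such that ∫_𝕋 |𝕀_α[F]| dν ≤ C·(sup_{n≥0, ω∈𝒜ℱ_n} m^{(1−α)n} ν(ω))·‖F‖_{L¹} for every finite nonnegative Borel measure ν on 𝕋 and every simple martingale F ∈ 𝕎. -/
open MeasureTheory Finset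

noncomputable section

namespace TracePaper

variable {ι : Type} [Fintype ι]
variable {E : Type} [AddCommGroup E] [Module ℝ E]

/-- A martingale adapted to the `ι`-uniform filtration, recorded by its values on atoms:
`val n c` is the value of `F_n` on the atom determined by the digit string `c`. -/
structure Mart (ι : Type) [Fintype ι] (E : Type) [AddCommGroup E] [Module ℝ E] where
  val : (n : ℕ) → (Fin n → ι) → E
  avg_eq : ∀ (n : ℕ) (c : Fin n → ι),
    val n c = (Fintype.card ι : ℝ)⁻¹ • ∑ j : ι, val (n + 1) (Fin.snoc c j)

/-- The martingale difference `dF_{n+1}|_ω` on the atom `ω = c ∈ 𝒜ℱ_n`, as an element of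
`V ⊗ E` (an `ι`-tuple with zero average). -/
def diff (F : Mart ι E) (n : ℕ) (c : Fin n → ι) : ι → E :=
  fun j => F.val (n + 1) (Fin.snoc c j) - F.val n c

/-- `F ∈ 𝕎`: all martingale differences lie in `W`. -/
def MemSpace (W : Set (ι → E)) (F : Mart ι E) : Prop :=
  ∀ (n : ℕ) (c : Fin n → ι), diff F n c ∈ W

/-- A simple martingale: all but finitely many differences vanish. -/
def Simple (F : Mart ι E) : Prop :=
  ∃ N : ℕ, ∀ n, N ≤ n → ∀ c : Fin n → ι, diff F n c = 0

/-- Average of an `ι`-tuple. -/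
def avg (X : ι → E) : E := (Fintype.card ι : ℝ)⁻¹ • ∑ j, X j

/-- The set `𝕄^W` of admissible `0`-flat increments. -/
def MW (W : Set (ι → E)) : Set (ι → ℝ) :=
  {v | (∑ j, v j = 0) ∧ (∀ j, -1 ≤ v j) ∧ ∃ a : E, a ≠ 0 ∧ (fun j => v j • a) ∈ W}

/-- `κ_v(θ) = θ log((1/m) ∑_j |1+v_j|^{1/θ})`, extended by continuity at `θ = 0`. -/
def kappaV (ι : Type) [Fintype ι] (v : ι → ℝ) (θ : ℝ) : ℝ :=
  if θ = 0 then Real.log (⨆ j, |1 + v j|)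
  else θ * Real.log ((Fintype.card ι : ℝ)⁻¹ * ∑ j, |1 + v j| ^ (1 / θ))

/-- `κ(θ) = sup {κ_v(θ) : v ∈ 𝕄^W}`. -/
def kappa (W : Set (ι → E)) (θ : ℝ) : ℝ :=
  sSup {r | ∃ v ∈ MW W, r = kappaV ι v θ}

/-- `κ'(1) = inf { -(1/m) ∑_j (1+v_j) log(1+v_j) : v ∈ 𝕄^W }`. -/
def kprime1 (W : Set (ι → E)) : ℝ :=
  sInf {r | ∃ v ∈ MW W,
    r = -((Fintype.card ι : ℝ)⁻¹ * ∑ j, (1 + v j) * Real.log (1 + v j))}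

/-- `W` is geometric (κ affine) with `α = -κ'(1)/log m`; equivalently
`κ(θ) = α (log m)(1-θ)` on `[0,1]`. -/
def GeometricOfOrder (W : Set (ι → E)) (α : ℝ) : Prop :=
  ∀ θ ∈ Set.Icc (0 : ℝ) 1, kappa W θ = α * Real.log (Fintype.card ι) * (1 - θ)

/-- `w = v ⊗ a` is an extremal vector with support `H`. -/
def IsExtremal (W : Set (ι → E)) (α : ℝ) (w : ι → E) (H : Finset ι) : Prop :=
  w ∈ W ∧ ∃ a : E, a ≠ 0 ∧ (H.card : ℝ) = (Fintype.card ι : ℝ) ^ ((1 : ℝ) - α) ∧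
    (∀ j ∈ H, w j = ((Fintype.card ι : ℝ) ^ α - 1) • a) ∧ ∀ j ∉ H, w j = -a

/-- `φ` is a canceling operator. -/
def Canceling (W : Set (ι → E)) (α : ℝ) (φ : (ι → E) → ι → ℝ) : Prop :=
  ∀ (w : ι → E) (H : Finset ι), IsExtremal W α w H → ∀ j ∈ H, φ w j = 0

/-- `W` is a non-local space (of order `α`). -/
def NonLocal (W : Set (ι → E)) (α : ℝ) : Prop :=
  ∀ (w : ι → E) (H : Finset ι), IsExtremal W α w H →
    ∀ u ∈ W, ∀ b : E, (∀ j ∉ H, b + u j = 0) → ∃ c : ℝ, u = c • w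

/-- The martingale transform `𝕀_α[F]`, as a function of the path `γ ∈ 𝕋`. -/
def Ialpha (φ : (ι → E) → ι → ℝ) (α : ℝ) (F : Mart ι E) (γ : ℕ → ι) : ℝ :=
  ∑' n : ℕ, (Fintype.card ι : ℝ) ^ (-(α * n)) *
    φ (diff F n (fun i : Fin n => γ i)) (γ n)

/-- The cylinder (atom of `ℱ_n`) determined by the digit string `c`. -/
def cyl (n : ℕ) (c : Fin n → ι) : Set (ℕ → ι) := {γ | ∀ i : Fin n, γ i = c i}

/-- The Borel σ-algebra of `𝕋` (= the product σ-algebra). -/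
def treeMS (ι : Type) : MeasurableSpace (ℕ → ι) :=
  @MeasurableSpace.pi ℕ (fun _ => ι) (fun _ => ⊤)

section Normed
variable {E' : Type} [NormedAddCommGroup E'] [NormedSpace ℝ E']

/-- `‖F‖_{L¹} = sup_n 𝔼 |F_n|`. -/
def L1Norm (F : Mart ι E') : ℝ :=
  ⨆ n : ℕ, ((Fintype.card ι : ℝ) ^ n)⁻¹ * ∑ c : Fin n → ι, ‖F.val n c‖

/-- The bilinear trace inequality
`∫_𝕋 |𝕀_α[F]| dν ≲ (sup_{n,ω} m^{(1-α)n} ν(ω)) ‖F‖_{L¹}`. -/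
def TraceIneq (W : Set (ι → E')) (φ : (ι → E') → ι → ℝ) (α : ℝ) : Prop :=
  ∃ C : ℝ, ∀ ν : @Measure (ℕ → ι) (treeMS ι), IsFiniteMeasure ν →
    ∀ F : Mart ι E', MemSpace W F → Simple F →
      ∀ A : ℝ,
        (∀ (n : ℕ) (c : Fin n → ι),
          (Fintype.card ι : ℝ) ^ (((1 : ℝ) - α) * n) * (ν (cyl n c)).toReal ≤ A) →
        ∫ γ, |Ialpha φ α F γ| ∂ν ≤ C * A * L1Norm F

/-- The Bellman main inequality for `G` on the Bellman domain. -/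
def MainInequality (W : Set (ι → E')) (φ : (ι → E') → ι → ℝ) (α : ℝ)
    (G : E' → ℝ → ℝ → ℝ → ℝ → ℝ) : Prop :=
  ∀ (X : ι → E') (y : ℝ) (Z T S : ι → ℝ),
    (∀ j, ‖X j‖ ≤ Z j) → (∀ j, 0 ≤ T j) → (∀ j, T j ≤ S j) →
    (fun j => X j - avg X) ∈ W →
    (Fintype.card ι : ℝ) ^ (-α) *
        ∑ j, G (X j) ((Fintype.card ι : ℝ) ^ α * y + φ (fun i => X i - avg X) j)
          (Z j) (T j) (S j)
      ≤ G (avg X) y ((Fintype.card ι : ℝ)⁻¹ * ∑ j, Z j) (∑ j, T j)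
          (max (∑ j, T j) ((Fintype.card ι : ℝ) ^ ((1 : ℝ) - α) * ⨆ j, S j))

/-- The boundary inequality `G(x, y, |x|, t, s) ≥ |y| t`. -/
def BoundaryIneq (G : E' → ℝ → ℝ → ℝ → ℝ → ℝ) : Prop :=
  ∀ (x : E') (y t s : ℝ), 0 ≤ t → t ≤ s → |y| * t ≤ G x y ‖x‖ t s

/-- A supersolution: main inequality + boundary inequality. -/
def Supersolution (W : Set (ι → E')) (φ : (ι → E') → ι → ℝ) (α : ℝ)
    (G : E' → ℝ → ℝ → ℝ → ℝ → ℝ) : Prop :=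
  MainInequality W φ α G ∧ BoundaryIneq G

end Normed

/-! ### Finite-dimensional linear algebra -/

theorem exists_bound_of_ker {M M' M'' : Type} [AddCommGroup M] [Module ℝ M]
    [NormedAddCommGroup M'] [NormedSpace ℝ M'] [FiniteDimensional ℝ M']
    [NormedAddCommGroup M''] [NormedSpace ℝ M'']
    (T : M →ₗ[ℝ] M') (L : M →ₗ[ℝ] M'') (h : ∀ z, T z = 0 → L z = 0) :
    ∃ C : ℝ, 0 ≤ C ∧ ∀ z, ‖L z‖ ≤ C * ‖T z‖ := by
  obtain ⟨s, hs⟩ := T.rangeRestrict.exists_rightInverse_of_surjective T.range_rangeRestrict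
  let G : LinearMap.range T →L[ℝ] M'' := LinearMap.toContinuousLinearMap (L ∘ₗ s)
  refine ⟨‖G‖, G.opNorm_nonneg, fun z => ?_⟩
  have h1 : T (s (T.rangeRestrict z)) = T z := by
    have := congrArg (fun f => f (T.rangeRestrict z)) hs
    simpa using congrArg Subtype.val this
  have h2 : L z = G (T.rangeRestrict z) := by
    have h3 : L (z - s (T.rangeRestrict z)) = 0 := h _ (by rw [map_sub, h1, sub_self])
    rw [map_sub, sub_eq_zero] at h3
    simpa [G] using h3
  rw [h2]
  exact G.le_opNorm _

/-- Consequence of non-locality and cancellation near extremal vectors with support `H`. -/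
theorem extremal_bound (m ℓ : ℕ) (hm : 2 ≤ m)
    (W : Submodule ℝ (Fin m → EuclideanSpace ℝ (Fin ℓ)))
    (φ : (Fin m → EuclideanSpace ℝ (Fin ℓ)) →ₗ[ℝ] (Fin m → ℝ))
    (α : ℝ) (hα : α ∈ Set.Ioo (0 : ℝ) 1)
    (hnl : NonLocal (W : Set (Fin m → EuclideanSpace ℝ (Fin ℓ))) α)
    (hcanc : Canceling (W : Set (Fin m → EuclideanSpace ℝ (Fin ℓ))) α (fun w => φ w))
    (H : Finset (Fin m)) :
    ∃ C : ℝ, 0 ≤ C ∧ ∀ w, IsExtremal (W : Set (Fin m → EuclideanSpace ℝ (Fin ℓ))) α w H →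
      ∀ x, ∀ u ∈ W, ∀ j ∈ H, |φ u j| ≤ C * ∑ i ∈ Hᶜ, ‖x + u i‖ ∧
        ‖x + u j‖ ≤ (m : ℝ) ^ α * ‖x‖ + C * ∑ i ∈ Hᶜ, ‖x + u i‖ := by
  classical
  by_cases hex : ∃ w, IsExtremal (W : Set (Fin m → EuclideanSpace ℝ (Fin ℓ))) α w H
  swap
  · exact ⟨0, le_rfl, fun w hw => (hex ⟨w, hw⟩).elim⟩
  obtain ⟨w, hw⟩ := hex
  have hw' := hw
  obtain ⟨hwW, a, ha, hcard, hwH, hwHc⟩ := hw'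
  have hm1 : (1 : ℝ) < m := by exact_mod_cast hm
  obtain ⟨j0, hj0⟩ : ∃ j0, j0 ∉ H := by
    by_contra hcon
    push Not at hcon
    have : H = Finset.univ := Finset.eq_univ_iff_forall.2 hcon
    rw [this] at hcard
    simp only [Finset.card_univ, Fintype.card_fin] at hcard
    have : (m : ℝ) ^ (1 - α) < (m : ℝ) ^ (1 : ℝ) :=
      Real.rpow_lt_rpow_of_exponent_lt hm1 (by linarith [hα.1])
    rw [Real.rpow_one] at this
    linarith
  let E := EuclideanSpace ℝ (Fin ℓ)
  let q : ℝ := (m : ℝ) ^ α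
  let T : (E × W) →ₗ[ℝ] (Fin m → E) :=
    LinearMap.pi fun i => if i ∈ H then 0 else
      LinearMap.fst ℝ E W + LinearMap.proj i ∘ₗ W.subtype ∘ₗ LinearMap.snd ℝ E W
  let L : (E × W) →ₗ[ℝ] ((Fin m → ℝ) × (Fin m → E)) :=
    LinearMap.prod
      (LinearMap.pi fun i => if i ∈ H then
        LinearMap.proj i ∘ₗ φ ∘ₗ W.subtype ∘ₗ LinearMap.snd ℝ E W else 0)
      (LinearMap.pi fun i => if i ∈ H then
        (LinearMap.fst ℝ E W + LinearMap.proj i ∘ₗ W.subtype ∘ₗ LinearMap.snd ℝ E W)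
          - q • LinearMap.fst ℝ E W else 0)
  have hTapp : ∀ (z : E × W) i, T z i = if i ∈ H then 0 else z.1 + (z.2 : Fin m → E) i := by
    intro z i
    by_cases hi : i ∈ H <;> simp [T, hi]
  have hL1 : ∀ (z : E × W) i, (L z).1 i = if i ∈ H then φ z.2 i else 0 := by
    intro z i
    by_cases hi : i ∈ H <;> simp [L, hi]
  have hL2 : ∀ (z : E × W) i, (L z).2 i =
      if i ∈ H then z.1 + (z.2 : Fin m → E) i - q • z.1 else 0 := by
    intro z i
    by_cases hi : i ∈ H <;> simp [L, hi]
  obtain ⟨C, hC, hbd⟩ := exists_bound_of_ker T L (by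
    rintro ⟨b, u⟩ hz
    have h0 : ∀ j ∉ H, b + (u : Fin m → E) j = 0 := by
      intro j hj
      have := hTapp (b, u) j
      rw [hz] at this
      simpa [hj] using this.symm
    obtain ⟨c, hc⟩ := hnl w H hw u u.2 b h0
    have hb : b = c • a := by
      have := h0 j0 hj0
      rw [hc, Pi.smul_apply, hwHc j0 hj0] at this
      rw [smul_neg, ← sub_eq_add_neg, sub_eq_zero] at this
      exact this
    refine Prod.ext (funext fun i => ?_) (funext fun i => ?_)
    · rw [hL1]
      split_ifs with hi
      · have := hcanc w H hw i hi
        simp only at this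
        simp [hc, this]
      · rfl
    · rw [hL2]
      split_ifs with hi
      · simp only [hc, Pi.smul_apply, hwH i hi, hb, Fintype.card_fin]
        change c • a + c • ((q - 1) • a) - q • c • a = 0
        module
      · rfl)
  refine ⟨C, hC, fun _ _ x u hu j hj => ?_⟩
  have hb := hbd (x, ⟨u, hu⟩)
  have hTn : ‖T (x, ⟨u, hu⟩)‖ ≤ ∑ i ∈ Hᶜ, ‖x + u i‖ := by
    refine (pi_norm_le_iff_of_nonneg (Finset.sum_nonneg fun _ _ => norm_nonneg _)).2 fun i => ?_
    rw [hTapp]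
    split_ifs with hi
    · simpa using Finset.sum_nonneg fun _ _ => norm_nonneg _
    · exact Finset.single_le_sum (f := fun i => ‖x + u i‖) (fun _ _ => norm_nonneg _)
        (Finset.mem_compl.2 hi)
  have hb2 : ‖L (x, ⟨u, hu⟩)‖ ≤ C * ∑ i ∈ Hᶜ, ‖x + u i‖ :=
    hb.trans (mul_le_mul_of_nonneg_left hTn hC)
  constructor
  · have h1 := (norm_le_pi_norm (L (x, ⟨u, hu⟩)).1 j).trans (norm_fst_le _)
    rw [hL1, if_pos hj] at h1
    exact h1.trans hb2
  · have h1 := (norm_le_pi_norm (L (x, ⟨u, hu⟩)).2 j).trans (norm_snd_le _)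
    rw [hL2, if_pos hj] at h1
    have h2 : ‖q • x‖ = q * ‖x‖ := by
      rw [norm_smul, Real.norm_of_nonneg (by positivity)]
    have h3 : ‖x + u j‖ ≤ ‖x + u j - q • x‖ + ‖q • x‖ := by
      simpa using norm_add_le (x + u j - q • x) (q • x)
    have h4 : ‖x + u j - q • x‖ ≤ C * ∑ i ∈ Hᶜ, ‖x + u i‖ := h1.trans hb2
    rw [h2] at h3
    change ‖x + u j‖ ≤ q * ‖x‖ + _
    linarith

/-- The geometric property bounds flat increments. -/
theorem flat_bound (m ℓ : ℕ) (hm : 2 ≤ m)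
    (W : Submodule ℝ (Fin m → EuclideanSpace ℝ (Fin ℓ)))
    (α : ℝ)
    (hgeom : GeometricOfOrder (W : Set (Fin m → EuclideanSpace ℝ (Fin ℓ))) α)
    (v : Fin m → ℝ) (hv : v ∈ MW (W : Set (Fin m → EuclideanSpace ℝ (Fin ℓ)))) (j : Fin m) :
    1 + v j ≤ (m : ℝ) ^ α := by
  have hm0 : (0 : ℝ) < m := by positivity
  have hbound : ∀ v ∈ MW (W : Set (Fin m → EuclideanSpace ℝ (Fin ℓ))), ∀ j, |1 + v j| ≤ m := by
    intro v hv j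
    rw [abs_of_nonneg (by linarith [hv.2.1 j])]
    have h1 : ∑ i, (1 + v i) = m := by
      rw [Finset.sum_add_distrib, hv.1]; simp
    rw [← h1]
    exact Finset.single_le_sum (f := fun i => 1 + v i) (fun i _ => by linarith [hv.2.1 i])
      (Finset.mem_univ j)
  have : Nonempty (Fin m) := ⟨j⟩
  have hle : ∀ v ∈ MW (W : Set (Fin m → EuclideanSpace ℝ (Fin ℓ))),
      kappaV (Fin m) v 0 ≤ Real.log m := by
    intro v hv
    rw [kappaV, if_pos rfl]
    have h0 : 0 ≤ ⨆ j, |1 + v j| := Real.iSup_nonneg fun _ => abs_nonneg _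
    have h1 : ⨆ j, |1 + v j| ≤ m := ciSup_le (hbound v hv)
    rcases h0.eq_or_lt with h | h
    · rw [← h, Real.log_zero]
      exact Real.log_nonneg (by exact_mod_cast (by omega : 1 ≤ m))
    · exact Real.log_le_log h h1
  have h0 := hgeom 0 ⟨le_rfl, zero_le_one⟩
  have h1 : kappaV (Fin m) v 0 ≤ kappa (W : Set (Fin m → EuclideanSpace ℝ (Fin ℓ))) 0 :=
    le_csSup ⟨Real.log m, by rintro r ⟨v, hv, rfl⟩; exact hle v hv⟩ ⟨v, hv, rfl⟩
  rw [h0, kappaV, if_pos rfl] at h1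
  simp only [Fintype.card_fin, sub_zero, mul_one] at h1
  rcases (by linarith [hv.2.1 j] : 0 ≤ 1 + v j).eq_or_lt with h | h
  · rw [← h]; positivity
  · have h2 : 1 + v j ≤ ⨆ j, |1 + v j| :=
      (le_abs_self _).trans (le_ciSup (f := fun j => |1 + v j|) (Set.finite_range _).bddAbove j)
    have h3 := (Real.log_le_log h h2).trans h1
    rw [Real.le_rpow_iff_log_le h hm0]
    exact h3

/-- Young-type inequality. -/
theorem rpow_le_young {t β : ℝ} (ht : 0 ≤ t) (h0 : 0 < β) (h1 : β < 1) :
    t ^ β ≤ 1 - β + β * t := by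
  have := rpow_one_add_le_one_add_mul_self (s := t - 1) (by linarith) h0.le h1.le
  rw [add_sub_cancel] at this
  linarith

theorem rpow_eq_young {t β : ℝ} (ht : 0 ≤ t) (h0 : 0 < β) (h1 : β < 1)
    (h : 1 - β + β * t ≤ t ^ β) : t = 1 := by
  by_contra hne
  have := rpow_one_add_lt_one_add_mul_self (s := t - 1) (by linarith) (sub_ne_zero.2 hne) h0 h1
  rw [add_sub_cancel] at this
  linarith

/-! ### The one-step inequality -/

/-- Structure of flat steps. -/
theorem flat_structure (m ℓ : ℕ) (x : EuclideanSpace ℝ (Fin ℓ))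
    (w : Fin m → EuclideanSpace ℝ (Fin ℓ)) (hw : ∑ j, w j = 0) (hx : x ≠ 0)
    (hD : ∑ j, ‖x + w j‖ ≤ m * ‖x‖) (j : Fin m) :
    x + w j = (‖x + w j‖ / ‖x‖) • x := by
  have hx0 : 0 < ‖x‖ := norm_pos_iff.2 hx
  have hle : ∀ i ∈ Finset.univ, inner ℝ (x + w i) x ≤ ‖x + w i‖ * ‖x‖ :=
    fun i _ => real_inner_le_norm _ _
  have hsum : ∑ i, inner ℝ (x + w i) x = m * ‖x‖ * ‖x‖ := by
    rw [← sum_inner, Finset.sum_add_distrib, hw, add_zero]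
    simp only [Finset.sum_const, Finset.card_univ, Fintype.card_fin]
    rw [← Nat.cast_smul_eq_nsmul ℝ, real_inner_smul_left, real_inner_self_eq_norm_mul_norm,
      mul_assoc]
  have heq : ∑ i, inner ℝ (x + w i) x = ∑ i, ‖x + w i‖ * ‖x‖ := by
    apply le_antisymm (Finset.sum_le_sum hle)
    rw [hsum, ← Finset.sum_mul]
    exact mul_le_mul_of_nonneg_right hD hx0.le
  have h1 := (Finset.sum_eq_sum_iff_of_le hle).1 heq j (Finset.mem_univ j)
  rw [inner_eq_norm_mul_iff_real] at h1
  rw [div_eq_inv_mul, mul_smul, ← h1, smul_smul, inv_mul_cancel₀ hx0.ne', one_smul]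

/-- If the flat step is lossless, it is extremal. -/
theorem lossless_extremal (m : ℕ) (q N β : ℝ) (hq : 0 < q) (hN : 0 < N)
    (hqN : q * N = m) (h0 : 0 < β) (h1 : β < 1) (lam p : Fin m → ℝ)
    (hl0 : ∀ j, 0 ≤ lam j) (hlq : ∀ j, lam j ≤ q) (hlsum : ∑ j, lam j = m)
    (hp0 : ∀ j, 0 ≤ p j) (hp1 : ∑ j, p j = 1)
    (hge : (m : ℝ) ≤ ∑ j, lam j * (N * p j) ^ β) :
    ∀ j, (lam j = 0 ∧ p j = 0) ∨ (lam j = q ∧ p j = 1 / N) := by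
  have hA : ∀ j, 0 ≤ lam j * ((1 - β + β * (N * p j)) - (N * p j) ^ β) := fun j =>
    mul_nonneg (hl0 j) (sub_nonneg.2 (rpow_le_young (mul_nonneg hN.le (hp0 j)) h0 h1))
  have hB : ∀ j, 0 ≤ β * N * ((q - lam j) * p j) := fun j =>
    mul_nonneg (mul_nonneg h0.le hN.le) (mul_nonneg (sub_nonneg.2 (hlq j)) (hp0 j))
  have hsum : ∑ j, (lam j * ((1 - β + β * (N * p j)) - (N * p j) ^ β)
      + β * N * ((q - lam j) * p j)) = m - ∑ j, lam j * (N * p j) ^ β := by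
    have : ∀ j, (lam j * ((1 - β + β * (N * p j)) - (N * p j) ^ β)
      + β * N * ((q - lam j) * p j)) = (1 - β) * lam j + β * (q * N) * p j
        - lam j * (N * p j) ^ β := fun j => by ring
    simp_rw [this]
    rw [Finset.sum_sub_distrib, Finset.sum_add_distrib, ← Finset.mul_sum, ← Finset.mul_sum,
      hlsum, hp1, hqN]
    ring
  have hz : ∀ j, lam j * ((1 - β + β * (N * p j)) - (N * p j) ^ β)
      + β * N * ((q - lam j) * p j) = 0 := by
    have h2 : ∑ j, (lam j * ((1 - β + β * (N * p j)) - (N * p j) ^ β)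
      + β * N * ((q - lam j) * p j)) = 0 :=
      le_antisymm (by rw [hsum]; linarith)
        (Finset.sum_nonneg fun j _ => add_nonneg (hA j) (hB j))
    have := (Finset.sum_eq_zero_iff_of_nonneg (fun j _ => add_nonneg (hA j) (hB j))).1 h2
    exact fun j => this j (Finset.mem_univ j)
  intro j
  have ha : lam j * ((1 - β + β * (N * p j)) - (N * p j) ^ β) = 0 := by
    linarith [hz j, hA j, hB j]
  have hb : β * N * ((q - lam j) * p j) = 0 := by linarith [hz j, hA j, hB j]
  have hb' : (q - lam j) * p j = 0 := by
    rcases mul_eq_zero.1 hb with h | h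
    · exact absurd h (mul_pos h0 hN).ne'
    · exact h
  rcases mul_eq_zero.1 ha with h | h
  · left
    refine ⟨h, ?_⟩
    rw [h, sub_zero] at hb'
    exact (mul_eq_zero.1 hb').resolve_left hq.ne'
  · right
    have h2 : N * p j = 1 := rpow_eq_young (mul_nonneg hN.le (hp0 j)) h0 h1 (by linarith)
    have h3 : p j ≠ 0 := by
      intro h4; rw [h4, mul_zero] at h2; exact zero_ne_one h2
    refine ⟨?_, by field_simp; linarith⟩
    linarith [(mul_eq_zero.1 hb').resolve_right h3]

/-- Arithmetic of the one-step inequality near an extremal vector. -/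
theorem near_extremal (m : ℕ) (q N β C0 c M r : ℝ) (hm : (0 : ℝ) < m) (hN : 0 < N)
    (hqN : q * N = m) (h0 : 0 < β) (hβ : β ≤ 1 / 2) (hC0 : 0 ≤ C0) (hβC : β * (N * C0) ≤ 1 / 8)
    (hc : 0 < c) (hcC : m * (c * C0) ≤ 1 / 4) (hcM : c * M ≤ β * r)
    (H : Finset (Fin m)) (X p f : Fin m → ℝ) (x : ℝ)
    (hX : ∀ j, 0 ≤ X j) (hxr : r ≤ x)
    (hp0 : ∀ j, 0 ≤ p j) (hp1 : ∑ j, p j = 1) (hf : ∀ j, f j ≤ M)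
    (hfH : ∀ j ∈ H, f j ≤ C0 * ∑ i ∈ Hᶜ, X i)
    (hXH : ∀ j ∈ H, X j ≤ q * x + C0 * ∑ i ∈ Hᶜ, X i)
    (hsm : ∀ j ∉ H, (N * p j) ^ β ≤ 1 / 8) (hD : (m : ℝ) * x ≤ ∑ j, X j) :
    (m : ℝ)⁻¹ * ∑ j, X j * (N * p j) ^ β + c * ∑ j, f j * p j
      ≤ x + 1 * ((m : ℝ)⁻¹ * ∑ j, X j - x) := by
  set ρ := ∑ i ∈ Hᶜ, X i with hρ
  set π' := ∑ i ∈ Hᶜ, p i with hπ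
  have hρ0 : 0 ≤ ρ := Finset.sum_nonneg fun i _ => hX i
  have hπ0 : 0 ≤ π' := Finset.sum_nonneg fun i _ => hp0 i
  have hpH : ∑ i ∈ H, p i = 1 - π' := by
    rw [← hp1, ← Finset.sum_add_sum_compl H p]; ring
  have hπ1 : π' ≤ 1 := by
    have : 0 ≤ ∑ i ∈ H, p i := Finset.sum_nonneg fun i _ => hp0 i
    linarith
  have hXHs : ∑ i ∈ H, X i = ∑ j, X j - ρ := by
    rw [← Finset.sum_add_sum_compl H X]; ring
  have s1 : ∑ j ∈ H, X j * (N * p j) ^ β ≤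
      (1 - β) * (∑ j, X j - ρ) + β * N * ((q * x + C0 * ρ) * (1 - π')) := by
    rw [← hXHs, ← hpH, Finset.mul_sum, Finset.mul_sum, Finset.mul_sum, ← Finset.sum_add_distrib]
    refine Finset.sum_le_sum fun j hj => ?_
    have e1 := mul_le_mul_of_nonneg_left
      (rpow_le_young (mul_nonneg hN.le (hp0 j)) h0 (by linarith)) (hX j)
    have e2 := mul_le_mul_of_nonneg_right (hXH j hj) (hp0 j)
    have e3 := mul_le_mul_of_nonneg_left e2 (mul_nonneg h0.le hN.le)
    calc _ ≤ _ := e1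
      _ = (1 - β) * X j + β * N * (X j * p j) := by ring
      _ ≤ _ := by linarith
  have s2 : ∑ j ∈ Hᶜ, X j * (N * p j) ^ β ≤ ρ * (1 / 8) := by
    rw [hρ, Finset.sum_mul]
    exact Finset.sum_le_sum fun j hj =>
      mul_le_mul_of_nonneg_left (hsm j (Finset.mem_compl.1 hj)) (hX j)
  have t1 : ∑ j ∈ H, f j * p j ≤ C0 * ρ * (1 - π') := by
    rw [← hpH, Finset.mul_sum]
    exact Finset.sum_le_sum fun j hj => mul_le_mul_of_nonneg_right (hfH j hj) (hp0 j)
  have t2 : ∑ j ∈ Hᶜ, f j * p j ≤ M * π' := by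
    rw [hπ, Finset.mul_sum]
    exact Finset.sum_le_sum fun j hj => mul_le_mul_of_nonneg_right (hf j) (hp0 j)
  have t1' : C0 * ρ * (1 - π') ≤ C0 * ρ :=
    mul_le_of_le_one_right (mul_nonneg hC0 hρ0) (by linarith)
  have s1' : β * N * ((q * x + C0 * ρ) * (1 - π')) ≤
      β * m * x - β * m * x * π' + (1 / 8) * ρ := by
    have e1 : β * N * ((q * x + C0 * ρ) * (1 - π')) =
      β * (q * N) * x - β * (q * N) * x * π' + (β * (N * C0)) * ρ * (1 - π') := by ring
    rw [e1, hqN]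
    have e2 : (β * (N * C0)) * ρ * (1 - π') ≤ (β * (N * C0)) * ρ :=
      mul_le_of_le_one_right (mul_nonneg (by positivity) hρ0) (by linarith)
    have e3 := mul_le_mul_of_nonneg_right hβC hρ0
    linarith
  have hS : ∑ j, X j * (N * p j) ^ β ≤ ∑ j, X j - ρ / 4 - β * m * x * π' := by
    rw [← Finset.sum_add_sum_compl H (fun j => X j * (N * p j) ^ β)]
    have e1 : β * (m * x) ≤ β * ∑ j, X j := mul_le_mul_of_nonneg_left hD h0.le
    have e2 : β * ρ ≤ 1 / 2 * ρ := mul_le_mul_of_nonneg_right hβ hρ0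
    linarith
  have hT : ∑ j, f j * p j ≤ C0 * ρ + M * π' := by
    rw [← Finset.sum_add_sum_compl H (fun j => f j * p j)]
    linarith
  have hT2 : m * (c * ∑ j, f j * p j) ≤ ρ / 4 + β * m * x * π' := by
    have e0 := mul_le_mul_of_nonneg_left hT (mul_pos hm hc).le
    have e1 := mul_le_mul_of_nonneg_right hcC hρ0
    have e2 := mul_le_mul_of_nonneg_right (mul_le_mul_of_nonneg_left
      (hcM.trans (mul_le_mul_of_nonneg_left hxr h0.le)) hm.le) hπ0
    linarith
  have hfin : (m : ℝ) * ((m : ℝ)⁻¹ * ∑ j, X j * (N * p j) ^ β + c * ∑ j, f j * p j)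
      ≤ m * (x + 1 * ((m : ℝ)⁻¹ * ∑ j, X j - x)) := by
    have e1 : (m : ℝ) * ((m : ℝ)⁻¹ * ∑ j, X j * (N * p j) ^ β + c * ∑ j, f j * p j) =
      ∑ j, X j * (N * p j) ^ β + m * (c * ∑ j, f j * p j) := by
      field_simp
    have e2 : m * (x + 1 * ((m : ℝ)⁻¹ * ∑ j, X j - x)) = ∑ j, X j := by
      field_simp; ring
    rw [e1, e2]
    linarith
  exact le_of_mul_le_mul_left hfin hm

/-- The one-step inequality. -/
theorem one_step (m ℓ : ℕ) (hm : 2 ≤ m)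
    (W : Submodule ℝ (Fin m → EuclideanSpace ℝ (Fin ℓ)))
    (hWV : ∀ w ∈ W, ∑ j, w j = 0)
    (φ : (Fin m → EuclideanSpace ℝ (Fin ℓ)) →ₗ[ℝ] (Fin m → ℝ))
    (α : ℝ) (hα : α ∈ Set.Ioo (0 : ℝ) 1)
    (hgeom : GeometricOfOrder (W : Set (Fin m → EuclideanSpace ℝ (Fin ℓ))) α)
    (hnl : NonLocal (W : Set (Fin m → EuclideanSpace ℝ (Fin ℓ))) α)
    (hcanc : Canceling (W : Set (Fin m → EuclideanSpace ℝ (Fin ℓ))) α (fun w => φ w)) :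
    ∃ β c C : ℝ, 0 < β ∧ β < 1 ∧ 0 < c ∧ 0 ≤ C ∧
      ∀ x, ∀ w ∈ W, ∀ p : Fin m → ℝ, (∀ j, 0 ≤ p j) → ∑ j, p j = 1 →
        (m : ℝ)⁻¹ * ∑ j, ‖x + w j‖ * ((m : ℝ) ^ (1 - α) * p j) ^ β + c * ∑ j, |φ w j| * p j
          ≤ ‖x‖ + C * ((m : ℝ)⁻¹ * ∑ j, ‖x + w j‖ - ‖x‖) := by
  classical
  have hm0 : (0 : ℝ) < m := by positivity
  set N : ℝ := (m : ℝ) ^ (1 - α) with hN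
  set q : ℝ := (m : ℝ) ^ α with hq
  have hN0 : 0 < N := by positivity
  have hq0 : 0 < q := by positivity
  have hqN : q * N = m := by
    rw [hq, hN, ← Real.rpow_add hm0]; simp
  choose CH hCH0 hCH using extremal_bound m ℓ hm W φ α hα hnl hcanc
  set C0 : ℝ := ∑ H, CH H with hC0
  have hC00 : 0 ≤ C0 := Finset.sum_nonneg fun H _ => hCH0 H
  have hCle : ∀ H, CH H ≤ C0 := fun H =>
    Finset.single_le_sum (f := CH) (fun H _ => hCH0 H) (Finset.mem_univ H)
  set β : ℝ := 1 / (8 * (N * C0) + 2) with hβ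
  have hNC : 0 ≤ N * C0 := mul_nonneg hN0.le hC00
  have hβ0 : 0 < β := by positivity
  have hβ2 : β ≤ 1 / 2 := by
    rw [hβ]; exact one_div_le_one_div_of_le (by norm_num) (by linarith)
  have hβC : β * (N * C0) ≤ 1 / 8 := by
    rw [hβ, one_div, inv_mul_le_iff₀ (by positivity)]; linarith
  have hβ1 : β < 1 := by linarith
  let Φ : (Fin m → EuclideanSpace ℝ (Fin ℓ)) →L[ℝ] (Fin m → ℝ) :=
    LinearMap.toContinuousLinearMap φ
  have hφc : Continuous (fun w => φ w) := Φ.continuous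
  have hφb : ∀ w j, |φ w j| ≤ ‖Φ‖ * ‖w‖ := fun w j =>
    (norm_le_pi_norm (φ w) j).trans (Φ.le_opNorm w)
  have hDnn : ∀ x, ∀ w ∈ W, (m : ℝ) * ‖x‖ ≤ ∑ j, ‖x + w j‖ := by
    intro x w hw
    have h1 : ∑ j, (x + w j) = (m : ℝ) • x := by
      rw [Finset.sum_add_distrib, hWV w hw, add_zero]
      simp only [Finset.sum_const, Finset.card_univ, Fintype.card_fin]
      rw [← Nat.cast_smul_eq_nsmul ℝ]
    have h2 := norm_sum_le Finset.univ (fun j => x + w j)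
    rw [h1, norm_smul, Real.norm_of_nonneg hm0.le] at h2
    exact h2
  have hDnn' : ∀ x, ∀ w ∈ W, 0 ≤ (m : ℝ)⁻¹ * ∑ j, ‖x + w j‖ - ‖x‖ := by
    intro x w hw
    rw [sub_nonneg, le_inv_mul_iff₀ hm0]
    exact hDnn x w hw
  let Z := (EuclideanSpace ℝ (Fin ℓ) × (Fin m → EuclideanSpace ℝ (Fin ℓ))) × (Fin m → ℝ)
  let K : Set Z := (Metric.sphere 0 1 ∩ {y | y.2 ∈ W}) ×ˢ stdSimplex ℝ (Fin m)
  let lhs : ℝ → Z → ℝ := fun c z =>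
    (m : ℝ)⁻¹ * ∑ j, ‖z.1.1 + z.1.2 j‖ * (N * z.2 j) ^ β + c * ∑ j, |φ z.1.2 j| * z.2 j
  let rhs : ℝ → Z → ℝ := fun C z =>
    ‖z.1.1‖ + C * ((m : ℝ)⁻¹ * ∑ j, ‖z.1.1 + z.1.2 j‖ - ‖z.1.1‖)
  have hlhs : ∀ c, Continuous (lhs c) := by
    intro c
    have h1 : ∀ j : Fin m, Continuous fun z : Z => φ z.1.2 j := fun j =>
      (continuous_apply j).comp (hφc.comp (continuous_snd.comp continuous_fst))
    have h4 : ∀ j : Fin m, Continuous fun z : Z => z.2 j := fun j =>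
      (continuous_apply j).comp continuous_snd
    have h2 : ∀ j : Fin m, Continuous fun z : Z => (N * z.2 j) ^ β := fun j =>
      Continuous.rpow_const (continuous_const.mul (h4 j)) (fun _ => Or.inr hβ0.le)
    have h3 : ∀ j : Fin m, Continuous fun z : Z => z.1.2 j := fun j => by fun_prop
    refine (continuous_const.mul (continuous_finsetSum _ fun j _ => ?_)).add
      (continuous_const.mul (continuous_finsetSum _ fun j _ => ?_))
    · exact ((continuous_fst.comp continuous_fst).add (h3 j)).norm.mul (h2 j)
    · exact (h1 j).abs.mul (h4 j)
  have hrhs : ∀ C, Continuous (rhs C) := by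
    intro C
    have h3 : ∀ j : Fin m, Continuous fun z : Z => z.1.2 j := fun j => by fun_prop
    have h5 : Continuous fun z : Z => z.1.1 := by fun_prop
    exact h5.norm.add (continuous_const.mul ((continuous_const.mul
      (continuous_finsetSum _ fun j _ => (h5.add (h3 j)).norm)).sub h5.norm))
  have hKc : IsCompact K := by
    refine IsCompact.prod ((isCompact_sphere _ _).inter_right ?_) (isCompact_stdSimplex ℝ _)
    exact (Submodule.closed_of_finiteDimensional W).preimage continuous_snd
  have hlmono : ∀ c c' : ℝ, c ≤ c' → ∀ z ∈ K, lhs c z ≤ lhs c' z := by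
    intro c c' hcc z hz
    have : 0 ≤ ∑ j, |φ z.1.2 j| * z.2 j :=
      Finset.sum_nonneg fun j _ => mul_nonneg (abs_nonneg _) (hz.2.1 j)
    exact add_le_add le_rfl (mul_le_mul_of_nonneg_right hcc this)
  have hrmono : ∀ C C' : ℝ, C ≤ C' → ∀ z ∈ K, rhs C z ≤ rhs C' z := by
    intro c c' hcc z hz
    exact add_le_add le_rfl (mul_le_mul_of_nonneg_right hcc (hDnn' _ _ hz.1.2))
  have hmain : ∃ c C : ℝ, 0 < c ∧ 0 ≤ C ∧ ∀ z ∈ K ∩ K, lhs c z ≤ rhs C z := by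
    refine hKc.induction_on (p := fun S => ∃ c C : ℝ, 0 < c ∧ 0 ≤ C ∧
      ∀ z ∈ S ∩ K, lhs c z ≤ rhs C z) ⟨1, 0, one_pos, le_rfl, by simp⟩ ?_ ?_ ?_
    · rintro s t hst ⟨c, C, hc, hC, h⟩
      exact ⟨c, C, hc, hC, fun z hz => h z ⟨hst hz.1, hz.2⟩⟩
    · rintro s t ⟨c, C, hc, hC, h⟩ ⟨c', C', hc', hC', h'⟩
      refine ⟨min c c', max C C', lt_min hc hc', le_max_of_le_left hC, ?_⟩
      rintro z ⟨hz | hz, hzK⟩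
      · exact (hlmono _ _ (min_le_left _ _) z hzK).trans
          ((h z ⟨hz, hzK⟩).trans (hrmono _ _ (le_max_left _ _) z hzK))
      · exact (hlmono _ _ (min_le_right _ _) z hzK).trans
          ((h' z ⟨hz, hzK⟩).trans (hrmono _ _ (le_max_right _ _) z hzK))
    intro z hz
    -- strict inequality at the point suffices
    have hstrict : (∃ c C : ℝ, 0 < c ∧ 0 ≤ C ∧ lhs c z < rhs C z) →
        ∃ t ∈ nhdsWithin z K, ∃ c C : ℝ, 0 < c ∧ 0 ≤ C ∧ ∀ z ∈ t ∩ K, lhs c z ≤ rhs C z := by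
      rintro ⟨c, C, hc, hC, h⟩
      refine ⟨{z | lhs c z < rhs C z}, mem_nhdsWithin_of_mem_nhds
        ((isOpen_lt (hlhs c) (hrhs C)).mem_nhds h), c, C, hc, hC, fun y hy => ?_⟩
      exact le_of_lt hy.1
    obtain ⟨⟨x, w⟩, p⟩ := z
    have hwW : w ∈ W := hz.1.2
    have hp0 : ∀ j, 0 ≤ p j := hz.2.1
    have hp1 : ∑ j, p j = 1 := hz.2.2
    have hxw : ‖(x, w)‖ = 1 := by simpa using hz.1.1
    rcases (hDnn' x w hwW).eq_or_lt with hD | hD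
    swap
    · -- convex case
      apply hstrict
      set D := (m : ℝ)⁻¹ * ∑ j, ‖x + w j‖ - ‖x‖ with hDdef
      refine ⟨1, (|lhs 1 ((x, w), p)| + 1) / D, one_pos, by positivity, ?_⟩
      have : rhs ((|lhs 1 ((x, w), p)| + 1) / D) ((x, w), p)
          = ‖x‖ + (|lhs 1 ((x, w), p)| + 1) := by
        change ‖x‖ + (|lhs 1 ((x, w), p)| + 1) / D * D = _
        rw [div_mul_cancel₀ _ hD.ne']
      rw [this]
      linarith [le_abs_self (lhs 1 ((x, w), p)), norm_nonneg x]
    -- flat case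
    have hsumX : ∑ j, ‖x + w j‖ = m * ‖x‖ := by
      have : (m : ℝ)⁻¹ * ∑ j, ‖x + w j‖ = ‖x‖ := by linarith
      rw [← this]; field_simp
    have hx : x ≠ 0 := by
      rintro rfl
      have h1 : ∑ j, ‖0 + w j‖ = 0 := by rw [hsumX]; simp
      have h2 : w = 0 := by
        funext j
        have := (Finset.sum_eq_zero_iff_of_nonneg (fun j _ => norm_nonneg _)).1 h1 j
          (Finset.mem_univ j)
        simpa using this
      rw [h2] at hxw
      simp at hxw
    have hx0 : 0 < ‖x‖ := norm_pos_iff.2 hx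
    set lam : Fin m → ℝ := fun j => ‖x + w j‖ / ‖x‖ with hlam
    have hXl : ∀ j, x + w j = lam j • x := fun j =>
      flat_structure m ℓ x w (hWV w hwW) hx hsumX.le j
    have hXn : ∀ j, ‖x + w j‖ = ‖x‖ * lam j := fun j => by
      simp only [hlam]; field_simp
    have hl0 : ∀ j, 0 ≤ lam j := fun j => by positivity
    have hlsum : ∑ j, lam j = m := by
      simp only [hlam]
      rw [← Finset.sum_div, hsumX]; field_simp
    have hwl : ∀ j, w j = (lam j - 1) • x := fun j => by
      rw [sub_smul, one_smul, ← hXl j]; abel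
    have hlq : ∀ j, lam j ≤ q := by
      intro j
      have := flat_bound m ℓ hm W α hgeom (fun j => lam j - 1)
        ⟨by rw [Finset.sum_sub_distrib, hlsum]; simp, fun j => by linarith [hl0 j],
          x, hx, by
            have : (fun j => (lam j - 1) • x) = w := (funext hwl).symm
            rw [this]; exact hwW⟩ j
      linarith
    by_cases hge : (m : ℝ) ≤ ∑ j, lam j * (N * p j) ^ β
    swap
    · push Not at hge
      apply hstrict
      have hl : (m : ℝ)⁻¹ * ∑ j, ‖x + w j‖ * (N * p j) ^ β < ‖x‖ := by
        have : ∑ j, ‖x + w j‖ * (N * p j) ^ β = ‖x‖ * ∑ j, lam j * (N * p j) ^ β := by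
          rw [Finset.mul_sum]
          exact Finset.sum_congr rfl fun j _ => by rw [hXn, mul_assoc]
        rw [this, inv_mul_lt_iff₀ hm0, mul_comm]
        exact mul_lt_mul_of_pos_right hge hx0
      set P := ∑ j, |φ w j| * p j with hP
      have hP0 : 0 ≤ P := Finset.sum_nonneg fun j _ => mul_nonneg (abs_nonneg _) (hp0 j)
      set g := ‖x‖ - (m : ℝ)⁻¹ * ∑ j, ‖x + w j‖ * (N * p j) ^ β with hg
      have hg0 : 0 < g := by linarith
      refine ⟨g / (P + 1), 0, by positivity, le_rfl, ?_⟩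
      change (m : ℝ)⁻¹ * ∑ j, ‖x + w j‖ * (N * p j) ^ β + g / (P + 1) * P < ‖x‖ + 0 * _
      have : g / (P + 1) * P < g := by
        rw [div_mul_eq_mul_div, div_lt_iff₀ (by linarith)]
        nlinarith
      rw [zero_mul]
      linarith
    -- extremal case
    have hdich := lossless_extremal m q N β hq0 hN0 hqN hβ0 hβ1 lam p hl0 hlq hlsum hp0 hp1 hge
    set H : Finset (Fin m) := Finset.univ.filter fun j => lam j = q with hH
    have hHc : ∀ j ∉ H, lam j = 0 ∧ p j = 0 := by
      intro j hj
      rcases hdich j with h | h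
      · exact h
      · exact absurd (by simp [hH, h.1]) hj
    have hHm : ∀ j ∈ H, lam j = q := fun j hj => by simpa [hH] using hj
    have hcard : (H.card : ℝ) = N := by
      have h1 : ∑ j ∈ H, lam j = m := by
        rw [← hlsum]
        exact Finset.sum_subset (Finset.subset_univ _) fun j _ hj => (hHc j hj).1
      rw [Finset.sum_congr rfl hHm, Finset.sum_const, nsmul_eq_mul, ← hqN, mul_comm] at h1
      exact mul_left_cancel₀ hq0.ne' h1
    have hext : IsExtremal (W : Set (Fin m → EuclideanSpace ℝ (Fin ℓ))) α w H := by
      refine ⟨hwW, x, hx, ?_, fun j hj => ?_, fun j hj => ?_⟩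
      · rw [hcard, Fintype.card_fin]
      · rw [hwl j, hHm j hj, Fintype.card_fin]
      · rw [hwl j, (hHc j hj).1]; simp
    set r := ‖x‖ / 2 with hr
    have hr0 : 0 < r := by positivity
    set M := ‖Φ‖ with hM
    have hM0 : 0 ≤ M := Φ.opNorm_nonneg
    obtain ⟨c, hc, hcC, hcM⟩ : ∃ c : ℝ, 0 < c ∧ m * (c * C0) ≤ 1 / 4 ∧ c * M ≤ β * r := by
      refine ⟨min (1 / (4 * (m * C0) + 4)) (β * r / (M + 1)), by positivity, ?_, ?_⟩
      · have h1 : 0 ≤ m * C0 := by positivity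
        calc _ = min (1 / (4 * (m * C0) + 4)) (β * r / (M + 1)) * (m * C0) := by ring
          _ ≤ 1 / (4 * (m * C0) + 4) * (m * C0) :=
            mul_le_mul_of_nonneg_right (min_le_left _ _) h1
          _ ≤ 1 / 4 := by
            rw [one_div, inv_mul_le_iff₀ (by positivity)]; linarith
      · calc _ ≤ β * r / (M + 1) * M := mul_le_mul_of_nonneg_right (min_le_right _ _) hM0
          _ ≤ β * r := by
            rw [div_mul_eq_mul_div, div_le_iff₀ (by linarith)]
            have : 0 < β * r := by positivity
            nlinarith
    let t : Set Z := {z | r < ‖z.1.1‖} ∩ ⋂ j ∈ Hᶜ, {z | (N * z.2 j) ^ β < 1 / 8}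
    refine ⟨t, mem_nhdsWithin_of_mem_nhds ?_, c, 1, hc, zero_le_one, ?_⟩
    · refine Filter.inter_mem ?_ ((Filter.biInter_finset_mem _).2 fun j hj => ?_)
      · refine (isOpen_lt continuous_const (by fun_prop)).mem_nhds ?_
        change ‖x‖ / 2 < ‖x‖
        linarith
      · refine (isOpen_lt (Continuous.rpow_const (continuous_const.mul
          ((continuous_apply j).comp continuous_snd)) fun _ => Or.inr hβ0.le)
          continuous_const).mem_nhds ?_
        change (N * p j) ^ β < 1 / 8
        rw [(hHc j (Finset.mem_compl.1 hj)).2, mul_zero, Real.zero_rpow hβ0.ne']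
        norm_num
    · rintro ⟨⟨y, u⟩, s⟩ ⟨⟨hy1, hy2⟩, hyK⟩
      have hu : u ∈ W := hyK.1.2
      have hyu : ‖(y, u)‖ = 1 := by simpa using hyK.1.1
      have hu1 : ‖u‖ ≤ 1 := (norm_snd_le (y, u)).trans hyu.le
      have hρ0 : 0 ≤ ∑ i ∈ Hᶜ, ‖y + u i‖ := Finset.sum_nonneg fun _ _ => norm_nonneg _
      have hle := mul_le_mul_of_nonneg_right (hCle H) hρ0
      refine near_extremal m q N β C0 c M r hm0 hN0 hqN hβ0 hβ2 hC00 hβC hc hcC hcM H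
        (fun j => ‖y + u j‖) s (fun j => |φ u j|) ‖y‖ (fun j => norm_nonneg _) (le_of_lt hy1)
        hyK.2.1 hyK.2.2 (fun j => ?_) (fun j hj => ?_) (fun j hj => ?_) (fun j hj => ?_)
        (hDnn y u hu)
      · exact (hφb u j).trans (mul_le_of_le_one_right hM0 hu1)
      · exact ((hCH H w hext y u hu j hj).1).trans hle
      · exact ((hCH H w hext y u hu j hj).2).trans (add_le_add le_rfl hle)
      · have := Set.mem_iInter₂.1 hy2 j (Finset.mem_compl.2 hj)
        exact le_of_lt this
  obtain ⟨c, C, hc, hC, hfin⟩ := hmain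
  refine ⟨β, c, C, hβ0, hβ1, hc, hC, fun x w hw p hp0 hp1 => ?_⟩
  by_cases hxw : (x, w) = 0
  · obtain ⟨rfl, rfl⟩ := Prod.mk_eq_zero.1 hxw
    simp
  set R := ‖(x, w)‖ with hR
  have hR0 : 0 < R := norm_pos_iff.2 hxw
  have hK : (((R⁻¹ • x, R⁻¹ • w), p) : Z) ∈ K := by
    refine ⟨⟨?_, W.smul_mem _ hw⟩, hp0, hp1⟩
    have : ((R⁻¹ • x, R⁻¹ • w) : EuclideanSpace ℝ (Fin ℓ) × (Fin m → EuclideanSpace ℝ (Fin ℓ)))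
      = R⁻¹ • (x, w) := rfl
    rw [mem_sphere_zero_iff_norm, this, norm_smul, norm_inv, norm_norm, ← hR,
      inv_mul_cancel₀ hR0.ne']
  have h := hfin _ ⟨hK, hK⟩
  have hn : ∀ y : EuclideanSpace ℝ (Fin ℓ), ‖R⁻¹ • y‖ = R⁻¹ * ‖y‖ := fun y => by
    rw [norm_smul, Real.norm_of_nonneg (by positivity)]
  have e1 : lhs c ((R⁻¹ • x, R⁻¹ • w), p) = R⁻¹ * ((m : ℝ)⁻¹ * ∑ j, ‖x + w j‖ * (N * p j) ^ β
      + c * ∑ j, |φ w j| * p j) := by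
    simp only [lhs, map_smul, Pi.smul_apply, ← smul_add, hn, smul_eq_mul, abs_mul,
      abs_of_pos (inv_pos.2 hR0), mul_assoc, ← Finset.mul_sum]
    ring
  have e2 : rhs C ((R⁻¹ • x, R⁻¹ • w), p) = R⁻¹ * (‖x‖ + C * ((m : ℝ)⁻¹ * ∑ j, ‖x + w j‖ - ‖x‖)) := by
    simp only [rhs, Pi.smul_apply, ← smul_add, hn, ← Finset.mul_sum]
    ring
  rw [e1, e2] at h
  exact le_of_mul_le_mul_left h (inv_pos.2 hR0)

/-! ### Summation over the tree -/

theorem sum_snoc (m n : ℕ) (f : (Fin (n + 1) → Fin m) → ℝ) :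
    ∑ c, f c = ∑ c : Fin n → Fin m, ∑ j, f (Fin.snoc c j) := by
  rw [← (Fin.snocEquiv (fun _ : Fin (n + 1) => Fin m)).sum_comp, Fintype.sum_prod_type,
    Finset.sum_comm]
  rfl

/-- Telescoping over the tree. -/
theorem tree_sum (m ℓ : ℕ) (hm : 2 ≤ m)
    (W : Submodule ℝ (Fin m → EuclideanSpace ℝ (Fin ℓ)))
    (φ : (Fin m → EuclideanSpace ℝ (Fin ℓ)) →ₗ[ℝ] (Fin m → ℝ))
    (N β c C : ℝ) (hN : 0 < N) (hβ0 : 0 < β) (hβ1 : β < 1) (hc : 0 < c) (hC : 0 ≤ C)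
    (hstep : ∀ x, ∀ w ∈ W, ∀ p : Fin m → ℝ, (∀ j, 0 ≤ p j) → ∑ j, p j = 1 →
        (m : ℝ)⁻¹ * ∑ j, ‖x + w j‖ * (N * p j) ^ β + c * ∑ j, |φ w j| * p j
          ≤ ‖x‖ + C * ((m : ℝ)⁻¹ * ∑ j, ‖x + w j‖ - ‖x‖))
    (F : Mart (Fin m) (EuclideanSpace ℝ (Fin ℓ)))
    (hF : MemSpace (W : Set (Fin m → EuclideanSpace ℝ (Fin ℓ))) F)
    (hmono : ∀ n c, (0 : ℝ) ≤ (m : ℝ)⁻¹ * ∑ j, ‖F.val (n + 1) (Fin.snoc c j)‖ - ‖F.val n c‖)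
    (t : (n : ℕ) → (Fin n → Fin m) → ℝ) (ht0 : ∀ n c, 0 ≤ t n c) (ht1 : ∀ n c, t n c ≤ 1)
    (hts : ∀ n c, ∑ j, t (n + 1) (Fin.snoc c j) = N * t n c) (n : ℕ) :
    ((m : ℝ) ^ n)⁻¹ * ∑ d : Fin n → Fin m, ‖F.val n d‖ * t n d ^ β
      + c * ∑ k ∈ Finset.range n, ((m : ℝ) ^ k)⁻¹ * ∑ d : Fin k → Fin m,
          ∑ j, |φ (diff F k d) j| * (N⁻¹ * t (k + 1) (Fin.snoc d j))
      ≤ ‖F.val 0 Fin.elim0‖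
        + C * (((m : ℝ) ^ n)⁻¹ * ∑ d : Fin n → Fin m, ‖F.val n d‖ - ‖F.val 0 Fin.elim0‖) := by
  have hm0 : (0 : ℝ) < m := by positivity
  -- local inequality
  have hloc : ∀ k (d : Fin k → Fin m),
      (m : ℝ)⁻¹ * ∑ j, ‖F.val (k + 1) (Fin.snoc d j)‖ * t (k + 1) (Fin.snoc d j) ^ β
        + c * ∑ j, |φ (diff F k d) j| * (N⁻¹ * t (k + 1) (Fin.snoc d j))
      ≤ ‖F.val k d‖ * t k d ^ β
        + C * ((m : ℝ)⁻¹ * ∑ j, ‖F.val (k + 1) (Fin.snoc d j)‖ - ‖F.val k d‖) := by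
    intro k d
    have hD := mul_nonneg hC (hmono k d)
    rcases (ht0 k d).eq_or_lt with h0 | h0
    · have hz : ∀ j, t (k + 1) (Fin.snoc d j) = 0 := by
        have h1 := hts k d
        rw [← h0, mul_zero] at h1
        have := (Finset.sum_eq_zero_iff_of_nonneg (fun j _ => ht0 (k + 1) (Fin.snoc d j))).1 h1
        exact fun j => this j (Finset.mem_univ j)
      simp only [hz, ← h0, Real.zero_rpow hβ0.ne', mul_zero, Finset.sum_const_zero, zero_add]
      exact hD
    set T := t k d with hT
    let p : Fin m → ℝ := fun j => t (k + 1) (Fin.snoc d j) / (N * T)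
    have hNT : 0 < N * T := mul_pos hN h0
    have h := hstep (F.val k d) (diff F k d) (hF k d) p
      (fun j => div_nonneg (ht0 _ _) hNT.le)
      (by simp only [p]; rw [← Finset.sum_div, hts, div_self hNT.ne'])
    have hX : ∀ j, F.val k d + diff F k d j = F.val (k + 1) (Fin.snoc d j) := fun j => by
      simp [diff]
    simp only [hX] at h
    have hTb : 0 < T ^ β := Real.rpow_pos_of_pos h0 β
    have h' := mul_le_mul_of_nonneg_left h hTb.le
    have hTb1 : T ^ β ≤ 1 := Real.rpow_le_one h0.le (ht1 k d) hβ0.le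
    have hTT : T ≤ T ^ β := by
      have := Real.rpow_le_rpow_of_exponent_ge h0 (ht1 k d) hβ1.le
      rwa [Real.rpow_one] at this
    have e1 : ∀ j, T ^ β * (‖F.val (k + 1) (Fin.snoc d j)‖ * (N * p j) ^ β) =
        ‖F.val (k + 1) (Fin.snoc d j)‖ * t (k + 1) (Fin.snoc d j) ^ β := by
      intro j
      have e2 : N * p j = t (k + 1) (Fin.snoc d j) / T := by
        simp only [p]; field_simp
      rw [e2, Real.div_rpow (ht0 _ _) h0.le]
      field_simp
    have e3 : ∑ j, |φ (diff F k d) j| * (N⁻¹ * t (k + 1) (Fin.snoc d j)) =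
        T * ∑ j, |φ (diff F k d) j| * p j := by
      rw [Finset.mul_sum]
      refine Finset.sum_congr rfl fun j _ => ?_
      simp only [p]; field_simp
    have hP0 : 0 ≤ ∑ j, |φ (diff F k d) j| * p j :=
      Finset.sum_nonneg fun j _ => mul_nonneg (abs_nonneg _) (div_nonneg (ht0 _ _) hNT.le)
    have e4 : T ^ β * ((m : ℝ)⁻¹ * ∑ j, ‖F.val (k + 1) (Fin.snoc d j)‖ * (N * p j) ^ β) =
        (m : ℝ)⁻¹ * ∑ j, ‖F.val (k + 1) (Fin.snoc d j)‖ * t (k + 1) (Fin.snoc d j) ^ β := by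
      rw [← Finset.sum_congr rfl (fun j _ => e1 j), ← Finset.mul_sum]; ring
    rw [mul_add, mul_add, e4] at h'
    rw [e3]
    have e5 := mul_le_mul_of_nonneg_left (mul_le_mul_of_nonneg_right hTT hP0) hc.le
    have e6 := mul_le_mul_of_nonneg_right hTb1 hD
    linarith
  induction n with
  | zero =>
    have : ∀ d : Fin 0 → Fin m, d = Fin.elim0 := fun d => Subsingleton.elim _ _
    have h1 : t 0 Fin.elim0 ^ β ≤ 1 := Real.rpow_le_one (ht0 _ _) (ht1 _ _) hβ0.le
    have h2 := mul_le_of_le_one_right (norm_nonneg (F.val 0 Fin.elim0)) h1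
    simp [this]
    simpa using h2
  | succ n ih =>
    rw [sum_snoc, sum_snoc, Finset.sum_range_succ]
    have h1 := Finset.sum_le_sum (s := Finset.univ) fun d (_ : d ∈ Finset.univ) => hloc n d
    have hmn : (0 : ℝ) ≤ ((m : ℝ) ^ n)⁻¹ := by positivity
    have h2 := mul_le_mul_of_nonneg_left h1 hmn
    simp only [Finset.sum_add_distrib, ← Finset.mul_sum, Finset.sum_sub_distrib] at h2
    have e : ((m : ℝ) ^ (n + 1))⁻¹ = ((m : ℝ) ^ n)⁻¹ * (m : ℝ)⁻¹ := by
      rw [pow_succ, mul_inv]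
    rw [e]
    linarith

/-! ### Measure-theoretic part -/

theorem measurableSet_cyl (m n : ℕ) (c : Fin n → Fin m) :
    MeasurableSet[treeMS (Fin m)] (cyl n c) := by
  let _ : MeasurableSpace (Fin m) := ⊤
  have : cyl n c = ⋂ i : Fin n, (fun γ : ℕ → Fin m => γ i) ⁻¹' {c i} := by
    ext γ; simp [cyl]
  rw [this]
  change @MeasurableSet _ (MeasurableSpace.pi) _
  exact MeasurableSet.iInter fun i => measurable_pi_apply _ (MeasurableSpace.measurableSet_top)

theorem integral_cyl (m n : ℕ) (ν : @Measure (ℕ → Fin m) (treeMS (Fin m)))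
    (hν : IsFiniteMeasure ν) (f : (Fin n → Fin m) → ℝ) :
    Integrable (fun γ => f (fun i : Fin n => γ i)) ν ∧
    ∫ γ, f (fun i : Fin n => γ i) ∂ν = ∑ c, f c * (ν (cyl n c)).toReal := by
  classical
  have h : (fun γ : ℕ → Fin m => f (fun i : Fin n => γ i)) =
      fun γ => ∑ c, (cyl n c).indicator (fun _ => f c) γ := by
    funext γ
    rw [Finset.sum_eq_single (fun i : Fin n => γ i)]
    · rw [Set.indicator_of_mem]; intro i; rfl
    · intro c _ hc
      rw [Set.indicator_of_notMem]
      intro hmem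
      exact hc (funext fun i => (hmem i).symm)
    · simp
  have hInt : ∀ c ∈ (Finset.univ : Finset (Fin n → Fin m)),
      Integrable ((cyl n c).indicator (fun _ => f c)) ν := fun c _ =>
    (integrable_const _).indicator (measurableSet_cyl m n c)
  rw [h]
  refine ⟨integrable_finsetSum _ hInt, ?_⟩
  rw [integral_finsetSum _ hInt]
  refine Finset.sum_congr rfl fun c _ => ?_
  rw [integral_indicator_const _ (measurableSet_cyl m n c), smul_eq_mul, mul_comm]
  rfl

theorem cyl_split (m n : ℕ) (ν : @Measure (ℕ → Fin m) (treeMS (Fin m)))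
    (hν : IsFiniteMeasure ν) (c : Fin n → Fin m) :
    ∑ j, (ν (cyl (n + 1) (Fin.snoc c j : Fin (n + 1) → Fin m))).toReal
      = (ν (cyl n c)).toReal := by
  have h : cyl n c = ⋃ j, cyl (n + 1) (Fin.snoc c j : Fin (n + 1) → Fin m) := by
    ext γ
    simp only [cyl, Set.mem_ofPred_eq, Set.mem_iUnion]
    constructor
    · intro hγ
      refine ⟨γ n, fun i => ?_⟩
      refine Fin.lastCases ?_ (fun i => ?_) i
      · simp
      · simpa using hγ i
    · rintro ⟨j, hj⟩ i
      simpa using hj i.castSucc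
  rw [h, measure_iUnion, tsum_fintype, ENNReal.toReal_sum]
  · exact fun _ _ => measure_ne_top _ _
  · intro i j hij
    refine Set.disjoint_left.2 fun γ hi hj => hij ?_
    have h1 := hi (Fin.last n)
    have h2 := hj (Fin.last n)
    simp at h1 h2
    exact h1.symm.trans h2
  · exact fun j => measurableSet_cyl m _ _

/-- Theorem `Main`: for a geometric non-local space `W ⊆ V ⊗ ℝ^ℓ` and a
canceling operator `φ : W → V`, the bilinear trace inequality holds at the endpoint
`α = -κ'(1)/log m`. -/
theorem statement0 (m ℓ : ℕ) (hm : 2 ≤ m) (hℓ : 1 ≤ ℓ)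
    (W : Submodule ℝ (Fin m → EuclideanSpace ℝ (Fin ℓ)))
    (hWV : ∀ w ∈ W, ∑ j, w j = 0)
    (φ : (Fin m → EuclideanSpace ℝ (Fin ℓ)) →ₗ[ℝ] (Fin m → ℝ))
    (hφV : ∀ w ∈ W, ∑ j, φ w j = 0)
    (α : ℝ) (hα : α ∈ Set.Ioo (0 : ℝ) 1)
    (hgeom : GeometricOfOrder (W : Set (Fin m → EuclideanSpace ℝ (Fin ℓ))) α)
    (hnl : NonLocal (W : Set (Fin m → EuclideanSpace ℝ (Fin ℓ))) α)
    (hcanc : Canceling (W : Set (Fin m → EuclideanSpace ℝ (Fin ℓ))) α (fun w => φ w)) :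
    TraceIneq (W : Set (Fin m → EuclideanSpace ℝ (Fin ℓ))) (fun w => φ w) α := by
  have hm0 : (0 : ℝ) < m := by positivity
  obtain ⟨β, c, C, hβ0, hβ1, hc, hC, hstep⟩ :=
    one_step m ℓ hm W hWV φ α hα hgeom hnl hcanc
  set N : ℝ := (m : ℝ) ^ (1 - α) with hN
  have hN0 : 0 < N := by positivity
  refine ⟨(1 + C) / c, fun ν hν F hF hsimple A hA => ?_⟩
  have hA' : ∀ (n : ℕ) (d : Fin n → Fin m), N ^ n * (ν (cyl n d)).toReal ≤ A := by
    intro n d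
    have := hA n d
    rwa [Fintype.card_fin, Real.rpow_mul_natCast hm0.le] at this
  have hA0 : (ν Set.univ).toReal ≤ A := by
    have := hA' 0 Fin.elim0
    have h2 : cyl 0 (Fin.elim0 : Fin 0 → Fin m) = Set.univ := by
      ext γ; simp [cyl]
    rwa [h2, pow_zero, one_mul] at this
  rcases (ENNReal.toReal_nonneg.trans hA0).eq_or_lt with hz | hApos
  · have h1 : (ν Set.univ).toReal = 0 := le_antisymm (by rwa [← hz] at hA0) ENNReal.toReal_nonneg
    have h2 : ν = 0 := by
      rw [← Measure.measure_univ_eq_zero]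
      exact ((ENNReal.toReal_eq_zero_iff _).1 h1).resolve_right (measure_ne_top _ _)
    rw [h2, ← hz]
    simp
  obtain ⟨n, hn⟩ := hsimple
  -- monotonicity of norms
  have hmono : ∀ k (d : Fin k → Fin m),
      (0 : ℝ) ≤ (m : ℝ)⁻¹ * ∑ j, ‖F.val (k + 1) (Fin.snoc d j)‖ - ‖F.val k d‖ := by
    intro k d
    rw [sub_nonneg, F.avg_eq k d, norm_smul, Fintype.card_fin,
      Real.norm_of_nonneg (by positivity)]
    exact mul_le_mul_of_nonneg_left (norm_sum_le _ _) (by positivity)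
  set a : ℕ → ℝ := fun k => ((m : ℝ) ^ k)⁻¹ * ∑ d : Fin k → Fin m, ‖F.val k d‖ with ha
  have hsucc : ∀ k, a (k + 1) =
      ((m : ℝ) ^ k)⁻¹ * ∑ d : Fin k → Fin m, (m : ℝ)⁻¹ * ∑ j, ‖F.val (k + 1) (Fin.snoc d j)‖ := by
    intro k
    simp only [ha]
    rw [sum_snoc, ← Finset.mul_sum, pow_succ, mul_inv]
    ring
  have hamono : Monotone a := by
    refine monotone_nat_of_le_succ fun k => ?_
    rw [hsucc]
    refine mul_le_mul_of_nonneg_left (Finset.sum_le_sum fun d _ => ?_) (by positivity)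
    linarith [hmono k d]
  have hastab : ∀ k, n ≤ k → a (k + 1) = a k := by
    intro k hk
    rw [hsucc]
    simp only [ha]
    congr 1
    refine Finset.sum_congr rfl fun d _ => ?_
    have : ∀ j, F.val (k + 1) (Fin.snoc d j) = F.val k d := fun j => by
      have := congrFun (hn k hk d) j
      exact sub_eq_zero.1 this
    simp only [this, Finset.sum_const, Finset.card_univ, Fintype.card_fin, nsmul_eq_mul]
    field_simp
  have hale : ∀ k, a k ≤ a n := by
    intro k
    rcases le_total k n with h | h
    · exact hamono h
    · induction k, h using Nat.le_induction with
      | base => exact le_rfl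
      | succ k hk ih => rw [hastab k hk]; exact ih
  have hL1 : ∀ k, a k ≤ L1Norm F := by
    intro k
    have : L1Norm F = ⨆ k, a k := by
      simp only [L1Norm, ha, Fintype.card_fin]
    rw [this]
    exact le_ciSup (f := a) ⟨a n, by rintro _ ⟨k, rfl⟩; exact hale k⟩ k
  -- normalized masses
  let t : (k : ℕ) → (Fin k → Fin m) → ℝ := fun k d => N ^ k * (ν (cyl k d)).toReal / A
  have htree := tree_sum m ℓ hm W φ N β c C hN0 hβ0 hβ1 hc hC hstep F hF hmono t
    (fun k d => div_nonneg (mul_nonneg (by positivity) ENNReal.toReal_nonneg) hApos.le)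
    (fun k d => (div_le_one hApos).2 (hA' k d))
    (fun k d => by
      simp only [t]
      rw [← Finset.sum_div, ← Finset.mul_sum, cyl_split m k ν hν d, pow_succ]
      ring) n
  -- the integral
  let f : (k : ℕ) → (Fin (k + 1) → Fin m) → ℝ := fun k d =>
    (m : ℝ) ^ (-(α * k)) * |φ (diff F k (fun i => d i.castSucc)) (d (Fin.last k))|
  have hpt : ∀ γ : ℕ → Fin m, |Ialpha (fun w => φ w) α F γ| ≤
      ∑ k ∈ Finset.range n, f k (fun i => γ i) := by
    intro γ
    have h1 : Ialpha (fun w => φ w) α F γ = ∑ k ∈ Finset.range n,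
        (m : ℝ) ^ (-(α * k)) * φ (diff F k (fun i : Fin k => γ i)) (γ k) := by
      rw [Ialpha, Fintype.card_fin]
      refine tsum_eq_sum fun k hk => ?_
      rw [hn k (by simpa using hk)]
      simp
    rw [h1]
    refine (Finset.abs_sum_le_sum_abs _ _).trans (Finset.sum_le_sum fun k _ => ?_)
    rw [abs_mul, abs_of_nonneg (by positivity)]
    simp [f]
  have hI : ∫ γ, |Ialpha (fun w => φ w) α F γ| ∂ν ≤
      ∑ k ∈ Finset.range n, ∑ d, f k d * (ν (cyl (k + 1) d)).toReal := by
    have hInt : ∀ k ∈ Finset.range n,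
        Integrable (fun γ : ℕ → Fin m => f k (fun i => γ i)) ν :=
      fun k _ => (integral_cyl m (k + 1) ν hν (f k)).1
    calc _ ≤ ∫ γ, ∑ k ∈ Finset.range n, f k (fun i => γ i) ∂ν :=
          integral_mono_of_nonneg (Filter.Eventually.of_forall fun γ => abs_nonneg _)
            (integrable_finsetSum _ hInt) (Filter.Eventually.of_forall hpt)
      _ = _ := by
          rw [integral_finsetSum _ hInt]
          exact Finset.sum_congr rfl fun k _ => (integral_cyl m (k + 1) ν hν (f k)).2
  have hIeq : ∑ k ∈ Finset.range n, ∑ d, f k d * (ν (cyl (k + 1) d)).toReal =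
      A * ∑ k ∈ Finset.range n, ((m : ℝ) ^ k)⁻¹ * ∑ d : Fin k → Fin m,
          ∑ j, |φ (diff F k d) j| * (N⁻¹ * t (k + 1) (Fin.snoc d j)) := by
    rw [Finset.mul_sum]
    refine Finset.sum_congr rfl fun k _ => ?_
    rw [sum_snoc, Finset.mul_sum, Finset.mul_sum]
    refine Finset.sum_congr rfl fun d _ => ?_
    rw [Finset.mul_sum, Finset.mul_sum]
    refine Finset.sum_congr rfl fun j _ => ?_
    have hpow : (m : ℝ) ^ (-(α * k)) = ((m : ℝ) ^ k)⁻¹ * N ^ k := by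
      rw [hN, ← Real.rpow_mul_natCast hm0.le, ← Real.rpow_natCast, ← Real.rpow_neg hm0.le,
        ← Real.rpow_add hm0]
      congr 1
      ring
    simp only [f, t, Fin.snoc_castSucc, Fin.snoc_last, hpow, pow_succ]
    field_simp
  set SS := ∑ k ∈ Finset.range n, ((m : ℝ) ^ k)⁻¹ * ∑ d : Fin k → Fin m,
          ∑ j, |φ (diff F k d) j| * (N⁻¹ * t (k + 1) (Fin.snoc d j)) with hS
  have hnn : 0 ≤ ((m : ℝ) ^ n)⁻¹ * ∑ d : Fin n → Fin m, ‖F.val n d‖ * t n d ^ β := by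
    refine mul_nonneg (by positivity) (Finset.sum_nonneg fun d _ => mul_nonneg (norm_nonneg _)
      (Real.rpow_nonneg ?_ _))
    exact div_nonneg (mul_nonneg (by positivity) ENNReal.toReal_nonneg) hApos.le
  have ha0 : ‖F.val 0 Fin.elim0‖ = a 0 := by
    have : ∀ d : Fin 0 → Fin m, d = Fin.elim0 := fun d => Subsingleton.elim _ _
    simp [ha, this]
  have hb : c * SS ≤ (1 + C) * L1Norm F := by
    have h1 := hL1 0
    have h2 := mul_le_mul_of_nonneg_left (hL1 n) hC
    have h3 : 0 ≤ C * ‖F.val 0 Fin.elim0‖ := mul_nonneg hC (norm_nonneg _)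
    change _ ≤ _ + C * (a n - _) at htree
    linarith
  have hb' : SS ≤ (1 + C) / c * L1Norm F := by
    rw [div_mul_eq_mul_div, le_div_iff₀ hc]; linarith
  calc _ ≤ A * SS := hI.trans hIeq.le
    _ ≤ A * ((1 + C) / c * L1Norm F) := mul_le_mul_of_nonneg_left hb' hApos.le
    _ = _ := by ring

end TracePaper
end
end

section
/- Let W ⊆ V⊗ℝ^ℓ be a linear subspace, let φ: W → V be any linear map, and let α ∈ (0,1) satisfy α > −κ′(1)/log m. Then there exists θ₀ ∈ (0,1) such that for every θ ∈ (θ₀,1) there exists M₁⁰ ≥ 1 such that for every M₁ ≥ M₁⁰ there exists M₂⁰ such that for every M₂ ≥ M₂⁰ the function G(x,y,z,t,s) = |y|·t + M₁·|x|·t^{1−θ}·s^{θ} + M₂·(z−|x|)·s is a supersolution, i.e. it satisfies the main inequality and the boundary inequality. -/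
open MeasureTheory Finset

noncomputable section

namespace TracePaper

variable {ι : Type} [Fintype ι]
variable {E : Type} [AddCommGroup E] [Module ℝ E]

theorem pow_bound (m u p : ℝ) (hm : 1 ≤ m) (hu : 0 ≤ u) (hum : u ≤ m) (hp : 1 ≤ p) :
    u ^ p ≤ u + (p - 1) * (u * Real.log u +
      (4 * (p - 1) + m * Real.log m * (m ^ (p - 1) - 1))) := by
  have hmp : 0 ≤ m * Real.log m * (m ^ (p - 1) - 1) := by
    have h1 := Real.log_nonneg hm
    have h2 : 1 ≤ m ^ (p - 1) := Real.one_le_rpow hm (by linarith)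
    have : 0 ≤ m ^ (p - 1) - 1 := by linarith
    positivity
  rcases hu.eq_or_lt with rfl | hu
  · rw [Real.zero_rpow (by linarith)]
    have : 0 ≤ p - 1 := by linarith
    simp only [Real.log_zero, mul_zero, zero_add]
    positivity
  set L := Real.log u with hL
  have hup : u ^ p = u * Real.exp ((p - 1) * L) := by
    rw [Real.rpow_def_of_pos hu]
    nth_rewrite 2 [← Real.exp_log hu]
    rw [← Real.exp_add]; congr 1; ring
  set e := Real.exp ((p - 1) * L) with he
  have hepos : 0 < e := Real.exp_pos _
  have h1 : e - 1 ≤ (p - 1) * (L * e) := by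
    have := Real.add_one_le_exp (-((p - 1) * L))
    have h2 : Real.exp (-((p - 1) * L)) * e = 1 := by rw [he, ← Real.exp_add]; simp
    nlinarith
  have key : u * (L * e) ≤ u * L + (4 * (p - 1) + m * Real.log m * (m ^ (p - 1) - 1)) := by
    rcases le_total u 1 with h | h
    · have hLn : L ≤ 0 := Real.log_nonpos hu.le h
      have h3 : 1 + (p - 1) * L ≤ e := by
        have := Real.add_one_le_exp ((p - 1) * L); linarith
      have h4 : u * L ^ 2 ≤ 4 := by
        have hs : 0 < √u := Real.sqrt_pos.2 hu
        have h5 := Real.abs_log_mul_self_lt (√u) hs (Real.sqrt_le_one.2 h)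
        have h6 : Real.log (√u) = L / 2 := Real.log_sqrt hu.le
        rw [h6] at h5
        have h7 : (L / 2 * √u) ^ 2 ≤ 1 := by
          rw [← sq_abs]
          exact pow_le_one₀ (abs_nonneg _) h5.le
        rw [mul_pow, Real.sq_sqrt hu.le] at h7
        nlinarith
      have h8 : u * L * (e - 1) ≤ u * L * ((p - 1) * L) :=
        mul_le_mul_of_nonpos_left (by linarith) (mul_nonpos_of_nonneg_of_nonpos hu.le hLn)
      have h9 : (p - 1) * (u * L ^ 2) ≤ (p - 1) * 4 :=
        mul_le_mul_of_nonneg_left h4 (by linarith)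
      nlinarith
    · have hL0 : 0 ≤ L := Real.log_nonneg h
      have hLm : L ≤ Real.log m := Real.log_le_log hu hum
      have he1 : e ≤ m ^ (p - 1) := by
        rw [Real.rpow_def_of_pos (by linarith), he]
        apply Real.exp_le_exp.2
        nlinarith
      have he2 : 1 ≤ e := Real.one_le_exp (mul_nonneg (by linarith) hL0)
      have : u * L * (e - 1) ≤ m * Real.log m * (m ^ (p - 1) - 1) := by
        apply mul_le_mul _ (by linarith) (by linarith)
        · exact mul_nonneg (by linarith) (Real.log_nonneg hm)
        · exact mul_le_mul hum hLm hL0 (by linarith)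
      nlinarith
  rw [hup]
  have : u * (e - 1) ≤ u * ((p - 1) * (L * e)) := mul_le_mul_of_nonneg_left h1 hu.le
  have h2 := mul_le_mul_of_nonneg_left key (sub_nonneg.2 hp)
  nlinarith

theorem v_le {m : ℕ} {v : Fin m → ℝ} (h0 : ∑ j, v j = 0) (h1 : ∀ j, -1 ≤ v j) (j : Fin m) :
    1 + v j ≤ m := by
  have h2 : ∑ j, (1 + v j) = m := by
    rw [Finset.sum_add_distrib, h0]; simp
  rw [← h2]
  exact Finset.single_le_sum (f := fun j => 1 + v j) (fun i _ => by linarith [h1 i])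
    (Finset.mem_univ j)

theorem core1 (m ℓ : ℕ) (hm : 2 ≤ m)
    (W : Submodule ℝ (Fin m → EuclideanSpace ℝ (Fin ℓ)))
    (α : ℝ)
    (hα' : -(kprime1 (W : Set (Fin m → EuclideanSpace ℝ (Fin ℓ)))) / Real.log m < α) :
    ∃ θ₀ ∈ Set.Ioo (0 : ℝ) 1, ∀ θ ∈ Set.Ioo θ₀ 1, ∃ c : ℝ, c < 1 ∧
      ∀ v ∈ MW (W : Set (Fin m → EuclideanSpace ℝ (Fin ℓ))),
        (m : ℝ) ^ (-(α * (1 - θ))) * ((m : ℝ)⁻¹ * ∑ j, (1 + v j) ^ (1 / θ)) ^ θ ≤ c := by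
  have hm1 : (1 : ℝ) < m := by exact_mod_cast (by omega : 1 < m)
  have hm0 : (0 : ℝ) < m := by linarith
  have hlog : 0 < Real.log m := Real.log_pos hm1
  set L₀ := -(kprime1 (W : Set (Fin m → EuclideanSpace ℝ (Fin ℓ)))) with hL₀
  rw [div_lt_iff₀ hlog] at hα'
  have hLv : ∀ v ∈ MW (W : Set (Fin m → EuclideanSpace ℝ (Fin ℓ))),
      (m : ℝ)⁻¹ * ∑ j, (1 + v j) * Real.log (1 + v j) ≤ L₀ := by
    intro v hv
    rw [hL₀, le_neg]
    apply csInf_le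
    · refine ⟨-((m : ℝ)⁻¹ * ∑ j : Fin m, m * Real.log m), ?_⟩
      rintro r ⟨w, hw, rfl⟩
      rw [Fintype.card_fin, neg_le_neg_iff]
      apply mul_le_mul_of_nonneg_left _ (by positivity)
      apply Finset.sum_le_sum
      intro j _
      have h0 : 0 ≤ 1 + w j := by linarith [hw.2.1 j]
      have h1 := v_le hw.1 hw.2.1 j
      rcases h0.eq_or_lt with h | h
      · rw [← h]; simp; positivity
      · exact (mul_le_mul_of_nonneg_left (Real.log_le_log h h1) h0).trans
          (mul_le_mul_of_nonneg_right h1 hlog.le)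
    · exact ⟨v, hv, by simp⟩
  let ε : ℝ → ℝ := fun p => 4 * (p - 1) + m * Real.log m * ((m : ℝ) ^ (p - 1) - 1)
  have hcont : ContinuousAt (fun θ : ℝ => ε (1 / θ)) 1 := by
    have h1 : ContinuousAt (fun θ : ℝ => 1 / θ - 1) 1 := by fun_prop (disch := norm_num)
    have h2 : ContinuousAt (fun θ : ℝ => (m : ℝ) ^ (1 / θ - 1)) 1 :=
      ContinuousAt.rpow continuousAt_const h1 (Or.inl hm0.ne')
    exact (continuousAt_const.mul h1).add (continuousAt_const.mul (h2.sub continuousAt_const))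
  have hev : ∀ᶠ θ in nhdsWithin (1 : ℝ) (Set.Iio 1), ε (1 / θ) < α * Real.log m - L₀ := by
    apply (hcont.eventually_lt continuousAt_const _).filter_mono nhdsWithin_le_nhds
    simp [ε]; linarith
  obtain ⟨l, hl, hl2⟩ := (mem_nhdsLT_iff_exists_Ioo_subset' (show (0 : ℝ) < 1 by norm_num)).1 hev
  refine ⟨max l (1 / 2), ⟨by simp, max_lt hl (by norm_num)⟩, ?_⟩
  rintro θ ⟨hθ1, hθ2⟩
  have hθl : l < θ := (le_max_left _ _).trans_lt hθ1
  have hθ0 : 0 < θ := lt_trans (by norm_num) ((le_max_right _ _).trans_lt hθ1)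
  have hε : ε (1 / θ) < α * Real.log m - L₀ := hl2 ⟨hθl, hθ2⟩
  have hp : 1 ≤ 1 / θ := by rw [le_div_iff₀ hθ0]; linarith
  refine ⟨Real.exp ((1 - θ) * (L₀ + ε (1 / θ) - α * Real.log m)), ?_, ?_⟩
  · rw [Real.exp_lt_one_iff]
    exact mul_neg_of_pos_of_neg (by linarith) (by linarith)
  intro v hv
  have hsum : (m : ℝ)⁻¹ * ∑ j, (1 + v j) ^ (1 / θ) ≤ 1 + (1 / θ - 1) * (L₀ + ε (1 / θ)) := by
    have h1 : ∑ j, (1 + v j) ^ (1 / θ) ≤ ∑ j, ((1 + v j) + (1 / θ - 1) *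
        ((1 + v j) * Real.log (1 + v j) + ε (1 / θ))) := by
      apply Finset.sum_le_sum
      intro j _
      exact pow_bound m (1 + v j) (1 / θ) hm1.le (by linarith [hv.2.1 j]) (v_le hv.1 hv.2.1 j) hp
    have h2 : (m : ℝ)⁻¹ * ∑ j, ((1 + v j) + (1 / θ - 1) *
        ((1 + v j) * Real.log (1 + v j) + ε (1 / θ))) = 1 + (1 / θ - 1) *
        ((m : ℝ)⁻¹ * ∑ j, (1 + v j) * Real.log (1 + v j) + ε (1 / θ)) := by
      rw [Finset.sum_add_distrib, Finset.sum_add_distrib, hv.1, ← Finset.mul_sum,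
        Finset.sum_add_distrib]
      simp only [Finset.sum_const, Finset.card_univ, Fintype.card_fin, nsmul_eq_mul]
      field_simp
      ring
    calc _ ≤ _ := mul_le_mul_of_nonneg_left h1 (by positivity)
      _ = _ := h2
      _ ≤ _ := by
        have := hLv v hv
        have h3 : 0 ≤ 1 / θ - 1 := by linarith
        gcongr
  have hnn : 0 ≤ (m : ℝ)⁻¹ * ∑ j, (1 + v j) ^ (1 / θ) := by
    apply mul_nonneg (by positivity)
    exact Finset.sum_nonneg fun j _ => Real.rpow_nonneg (by linarith [hv.2.1 j]) _
  have h3 : ((m : ℝ)⁻¹ * ∑ j, (1 + v j) ^ (1 / θ)) ^ θ ≤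
      Real.exp ((1 - θ) * (L₀ + ε (1 / θ))) := by
    calc _ ≤ (Real.exp ((1 / θ - 1) * (L₀ + ε (1 / θ)))) ^ θ := by
          apply Real.rpow_le_rpow hnn _ hθ0.le
          refine hsum.trans ?_
          rw [add_comm]; exact Real.add_one_le_exp _
      _ = _ := by
          rw [← Real.exp_mul]; congr 1; field_simp
  calc _ ≤ (m : ℝ) ^ (-(α * (1 - θ))) * Real.exp ((1 - θ) * (L₀ + ε (1 / θ))) :=
        mul_le_mul_of_nonneg_left h3 (by positivity)
    _ = _ := by
        rw [Real.rpow_def_of_pos hm0, ← Real.exp_add]; congr 1; ring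

theorem core2 {F : Type} [NormedAddCommGroup F] [NormedSpace ℝ F] [FiniteDimensional ℝ F]
    (U : Submodule ℝ F) (B D : F → ℝ) (hB : Continuous B) (hD : Continuous D)
    (hBh : ∀ (c : ℝ) x, 0 ≤ c → B (c • x) = c * B x)
    (hDh : ∀ (c : ℝ) x, 0 ≤ c → D (c • x) = c * D x)
    (hD0 : ∀ x, 0 ≤ D x) (hpos : ∀ x ∈ U, x ≠ 0 → D x = 0 → 0 < B x) :
    ∃ M₀ : ℝ, ∀ M : ℝ, M₀ ≤ M → ∀ x ∈ U, 0 ≤ B x + M * D x := by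
  have : ProperSpace F := FiniteDimensional.proper ℝ F
  suffices h : ∃ M₀ : ℝ, ∀ M : ℝ, M₀ ≤ M → ∀ x ∈ U, ‖x‖ = 1 → 0 ≤ B x + M * D x by
    obtain ⟨M₀, h⟩ := h
    refine ⟨M₀, fun M hM x hx => ?_⟩
    by_cases hx0 : x = 0
    · have h1 := hBh 0 0 le_rfl
      have h2 := hDh 0 0 le_rfl
      simp only [smul_zero, zero_mul] at h1 h2
      rw [hx0, h1, h2]; simp
    · have hn : 0 < ‖x‖ := norm_pos_iff.2 hx0
      have h1 := h M hM (‖x‖⁻¹ • x) (U.smul_mem _ hx) (by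
        rw [norm_smul, norm_inv, norm_norm, inv_mul_cancel₀ hn.ne'])
      rw [hBh _ _ (by positivity), hDh _ _ (by positivity)] at h1
      have h2 : 0 ≤ ‖x‖⁻¹ * (B x + M * D x) := by linarith
      exact nonneg_of_mul_nonneg_right h2 (by positivity)
  let K : Set F := {x | ‖x‖ = 1} ∩ (U : Set F) ∩ {x | B x ≤ 0}
  have hK : IsCompact K := by
    have hs : IsCompact {x : F | ‖x‖ = 1} := by
      convert isCompact_sphere (0 : F) 1 using 1
      ext x; simp
    exact (hs.inter_right U.closed_of_finiteDimensional).inter_right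
      (isClosed_le hB continuous_const)
  by_cases hne : K.Nonempty
  · obtain ⟨x₁, hx₁, hmin⟩ := hK.exists_isMinOn hne hD.continuousOn
    obtain ⟨x₂, hx₂, hminB⟩ := hK.exists_isMinOn hne hB.continuousOn
    have hd : 0 < D x₁ := by
      refine lt_of_le_of_ne (hD0 _) fun h => ?_
      have := hpos x₁ hx₁.1.2 (by
        rintro rfl
        have := hx₁.1.1
        simp at this) h.symm
      exact absurd this (not_lt.2 hx₁.2)
    refine ⟨-(B x₂) / D x₁, fun M hM x hx hxn => ?_⟩
    have hM0 : 0 ≤ M := le_trans (div_nonneg (neg_nonneg.2 hx₂.2) hd.le) hM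
    rcases le_total 0 (B x) with h | h
    · exact add_nonneg h (mul_nonneg hM0 (hD0 x))
    · have hxK : x ∈ K := ⟨⟨hxn, hx⟩, h⟩
      have h1 : D x₁ ≤ D x := hmin hxK
      have h2 : B x₂ ≤ B x := hminB hxK
      rw [div_le_iff₀ hd] at hM
      nlinarith
  · refine ⟨0, fun M hM x hx hxn => ?_⟩
    have h : 0 ≤ B x := by
      by_contra h
      exact hne ⟨x, ⟨⟨hxn, hx⟩, (not_le.1 h).le⟩⟩
    exact add_nonneg h (mul_nonneg hM (hD0 x))

theorem collinear {m ℓ : ℕ} (hm : 2 ≤ m)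
    (X : Fin m → EuclideanSpace ℝ (Fin ℓ))
    (h : (m : ℝ)⁻¹ * ∑ j, ‖X j‖ - ‖avg X‖ = 0) (hX : X ≠ 0) :
    0 < ‖avg X‖ ∧ ∀ j, X j = (‖X j‖ / ‖avg X‖) • avg X := by
  have hm0 : (0 : ℝ) < m := by exact_mod_cast (by omega : 0 < m)
  have hsum : ∑ j, ‖X j‖ = m * ‖avg X‖ := by field_simp at h; linarith
  have hsX : ∑ j, X j = (m : ℝ) • avg X := by
    rw [avg, Fintype.card_fin, smul_inv_smul₀ hm0.ne']
  have hpos : 0 < ‖avg X‖ := by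
    refine lt_of_le_of_ne (norm_nonneg _) fun h0 => hX ?_
    rw [← h0, mul_zero, Finset.sum_eq_zero_iff_of_nonneg (fun _ _ => norm_nonneg _)] at hsum
    funext j
    exact norm_eq_zero.1 (hsum j (Finset.mem_univ j))
  refine ⟨hpos, fun j => ?_⟩
  have h1 : ∑ j, (‖X j‖ * ‖avg X‖ - inner ℝ (X j) (avg X)) = 0 := by
    rw [Finset.sum_sub_distrib, ← Finset.sum_mul, hsum, ← sum_inner, hsX, real_inner_smul_left,
      real_inner_self_eq_norm_sq]
    ring
  rw [Finset.sum_eq_zero_iff_of_nonneg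
    (fun j _ => sub_nonneg.2 (real_inner_le_norm _ _))] at h1
  have h2 := inner_eq_norm_mul_iff_real.1 (sub_eq_zero.1 (h1 j (Finset.mem_univ j))).symm
  rw [div_eq_inv_mul, mul_smul, ← h2, inv_smul_smul₀ hpos.ne']

theorem reduction (m ℓ : ℕ) (hm : 2 ≤ m)
    (W : Submodule ℝ (Fin m → EuclideanSpace ℝ (Fin ℓ)))
    (φ : (Fin m → EuclideanSpace ℝ (Fin ℓ)) →ₗ[ℝ] (Fin m → ℝ))
    (α θ M₁ M₂ : ℝ) (hα : α ∈ Set.Ioo (0 : ℝ) 1) (hθ : θ ∈ Set.Ioo (0 : ℝ) 1)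
    (hM₁ : 0 ≤ M₁) (hM₂ : 0 ≤ M₂)
    (H : ∀ X : Fin m → EuclideanSpace ℝ (Fin ℓ), (fun j => X j - avg X) ∈ W →
      0 ≤ (M₁ * ‖avg X‖ - (m : ℝ) ^ (-α) * ∑ j, |φ (fun i => X i - avg X) j|
        - M₁ * ((m : ℝ) ^ (-(α * (1 - θ))) * ((m : ℝ)⁻¹ * ∑ j, ‖X j‖ ^ (1 / θ)) ^ θ))
        + M₂ * ((m : ℝ)⁻¹ * ∑ j, ‖X j‖ - ‖avg X‖)) :
    MainInequality (W : Set (Fin m → EuclideanSpace ℝ (Fin ℓ))) (fun w => φ w) α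
      (fun x y z t s =>
        |y| * t + M₁ * ‖x‖ * t ^ (1 - θ) * s ^ θ + M₂ * (z - ‖x‖) * s) := by
  intro X y Z T S hZ hT hTS hW
  have hX := H X hW
  simp only [Fintype.card_fin]
  obtain ⟨hα0, hα1⟩ := hα
  obtain ⟨hθ0, hθ1⟩ := hθ
  have hm0 : (0 : ℝ) < m := by exact_mod_cast (by omega : 0 < m)
  set t := ∑ j, T j with ht
  set s := max t ((m : ℝ) ^ (1 - α) * ⨆ j, S j) with hs
  set f := φ (fun i => X i - avg X) with hf
  have ht0 : 0 ≤ t := Finset.sum_nonneg fun j _ => hT j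
  have hts : t ≤ s := le_max_left _ _
  have hs0 : 0 ≤ s := ht0.trans hts
  have hTt : ∀ j, T j ≤ t := fun j => Finset.single_le_sum (fun i _ => hT i) (Finset.mem_univ j)
  have hS0 : ∀ j, 0 ≤ S j := fun j => (hT j).trans (hTS j)
  have hSs : ∀ j, S j ≤ (m : ℝ) ^ (α - 1) * s := by
    intro j
    have h1 : S j ≤ ⨆ j, S j := le_ciSup (Set.finite_range S).bddAbove j
    have h2 : (m : ℝ) ^ (1 - α) * ⨆ j, S j ≤ s := le_max_right _ _
    have h3 : (m : ℝ) ^ (α - 1) * (m : ℝ) ^ (1 - α) = 1 := by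
      rw [← Real.rpow_add hm0]; simp
    calc S j ≤ ⨆ j, S j := h1
      _ = (m : ℝ) ^ (α - 1) * ((m : ℝ) ^ (1 - α) * ⨆ j, S j) := by rw [← mul_assoc, h3, one_mul]
      _ ≤ _ := mul_le_mul_of_nonneg_left h2 (by positivity)
  set R := t ^ (1 - θ) * s ^ θ with hR
  have hR0 : 0 ≤ R := by positivity
  have htR : t ≤ R := by
    calc t = t ^ ((1 - θ) + θ) := by simp
      _ = t ^ (1 - θ) * t ^ θ := Real.rpow_add_of_nonneg ht0 (by linarith) hθ0.le
      _ ≤ t ^ (1 - θ) * s ^ θ := by gcongr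
  have hRs : R ≤ s := by
    calc R ≤ s ^ (1 - θ) * s ^ θ := by
          exact mul_le_mul_of_nonneg_right (Real.rpow_le_rpow ht0 hts (by linarith))
            (Real.rpow_nonneg hs0 _)
      _ = s ^ ((1 - θ) + θ) := (Real.rpow_add_of_nonneg hs0 (by linarith) hθ0.le).symm
      _ = s := by simp
  -- the three parts
  have hsplit : (m : ℝ) ^ (-α) * ∑ j, (|(m : ℝ) ^ α * y + f j| * T j +
      M₁ * ‖X j‖ * T j ^ (1 - θ) * S j ^ θ + M₂ * (Z j - ‖X j‖) * S j) =
      ∑ j, (m : ℝ) ^ (-α) * (|(m : ℝ) ^ α * y + f j| * T j) +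
      M₁ * ((m : ℝ) ^ (-α) * ∑ j, ‖X j‖ * T j ^ (1 - θ) * S j ^ θ) +
      M₂ * ((m : ℝ) ^ (-α) * ∑ j, (Z j - ‖X j‖) * S j) := by
    simp only [Finset.mul_sum, ← Finset.sum_add_distrib]
    exact Finset.sum_congr rfl fun j _ => by ring
  have hma : (m : ℝ) ^ (-α) * (m : ℝ) ^ α = 1 := by rw [← Real.rpow_add hm0]; simp
  have p1 : ∑ j, (m : ℝ) ^ (-α) * (|(m : ℝ) ^ α * y + f j| * T j) ≤
      |y| * t + ((m : ℝ) ^ (-α) * ∑ j, |f j|) * R := by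
    rw [ht, Finset.mul_sum, Finset.mul_sum, Finset.sum_mul, ← Finset.sum_add_distrib]
    apply Finset.sum_le_sum
    intro j _
    have h1 : |(m : ℝ) ^ α * y + f j| ≤ (m : ℝ) ^ α * |y| + |f j| := by
      refine (abs_add_le _ _).trans ?_
      rw [abs_mul, abs_of_pos (by positivity : (0 : ℝ) < (m : ℝ) ^ α)]
    have h2 : T j ≤ R := (hTt j).trans htR
    calc _ ≤ (m : ℝ) ^ (-α) * (((m : ℝ) ^ α * |y| + |f j|) * T j) := by
          have := hT j
          gcongr
      _ = ((m : ℝ) ^ (-α) * (m : ℝ) ^ α) * |y| * T j + (m : ℝ) ^ (-α) * |f j| * T j := by ring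
      _ ≤ _ := by
          rw [hma, one_mul]
          gcongr
  have p2 : (m : ℝ) ^ (-α) * ∑ j, ‖X j‖ * T j ^ (1 - θ) * S j ^ θ ≤
      ((m : ℝ) ^ (-(α * (1 - θ))) * ((m : ℝ)⁻¹ * ∑ j, ‖X j‖ ^ (1 / θ)) ^ θ) * R := by
    have h1 : ∑ j, ‖X j‖ * T j ^ (1 - θ) * S j ^ θ ≤
        (∑ j, ‖X j‖ * T j ^ (1 - θ)) * ((m : ℝ) ^ (α - 1) * s) ^ θ := by
      rw [Finset.sum_mul]
      apply Finset.sum_le_sum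
      intro j _
      have := hSs j
      have := hS0 j
      have := Real.rpow_nonneg (hT j) (1 - θ)
      gcongr
    have h2 : ∑ j, ‖X j‖ * T j ^ (1 - θ) ≤ (∑ j, ‖X j‖ ^ (1 / θ)) ^ θ * t ^ (1 - θ) := by
      have hpq : (1 / θ).HolderConjugate (1 / (1 - θ)) := by
        rw [Real.holderConjugate_iff]
        constructor
        · rw [lt_div_iff₀ hθ0]; linarith
        · simp
      have := Real.inner_le_Lp_mul_Lq_of_nonneg Finset.univ hpq
        (f := fun j => ‖X j‖) (g := fun j => T j ^ (1 - θ)) (fun _ _ => norm_nonneg _)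
        (fun j _ => Real.rpow_nonneg (hT j) _)
      refine this.trans (le_of_eq ?_)
      have h3 : ∀ j, (T j ^ (1 - θ)) ^ (1 / (1 - θ)) = T j := fun j => by
        rw [← Real.rpow_mul (hT j), mul_one_div_cancel (by linarith), Real.rpow_one]
      simp only [h3, one_div_one_div, ht]
    have hP : 0 ≤ ∑ j, ‖X j‖ ^ (1 / θ) := Finset.sum_nonneg fun j _ => by positivity
    calc _ ≤ (m : ℝ) ^ (-α) * (((∑ j, ‖X j‖ ^ (1 / θ)) ^ θ * t ^ (1 - θ)) *
          ((m : ℝ) ^ (α - 1) * s) ^ θ) := by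
          apply mul_le_mul_of_nonneg_left _ (by positivity)
          exact h1.trans (mul_le_mul_of_nonneg_right h2 (by positivity))
      _ = _ := by
          rw [Real.mul_rpow (by positivity) hs0, Real.mul_rpow (by positivity) hP, hR,
            ← Real.rpow_mul hm0.le, Real.inv_rpow hm0.le, ← Real.rpow_neg hm0.le]
          have : (m : ℝ) ^ (-α) * (m : ℝ) ^ ((α - 1) * θ) =
              (m : ℝ) ^ (-(α * (1 - θ))) * (m : ℝ) ^ (-θ) := by
            rw [← Real.rpow_add hm0, ← Real.rpow_add hm0]; congr 1; ring
          linear_combination ((∑ j, ‖X j‖ ^ (1 / θ)) ^ θ * t ^ (1 - θ) * s ^ θ) * this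
  have p3 : (m : ℝ) ^ (-α) * ∑ j, (Z j - ‖X j‖) * S j ≤
      ((m : ℝ)⁻¹ * ∑ j, Z j - (m : ℝ)⁻¹ * ∑ j, ‖X j‖) * s := by
    have h1 : ∑ j, (Z j - ‖X j‖) * S j ≤ ∑ j, (Z j - ‖X j‖) * ((m : ℝ) ^ (α - 1) * s) :=
      Finset.sum_le_sum fun j _ =>
        mul_le_mul_of_nonneg_left (hSs j) (sub_nonneg.2 (hZ j))
    refine (mul_le_mul_of_nonneg_left h1 (by positivity)).trans (le_of_eq ?_)
    rw [← Finset.sum_mul, Finset.sum_sub_distrib]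
    have : (m : ℝ) ^ (-α) * (m : ℝ) ^ (α - 1) = (m : ℝ)⁻¹ := by
      rw [← Real.rpow_add hm0, ← Real.rpow_neg_one]; congr 1; ring
    linear_combination (∑ j, Z j - ∑ j, ‖X j‖) * s * this
  have hD : 0 ≤ (m : ℝ)⁻¹ * ∑ j, ‖X j‖ - ‖avg X‖ := by
    rw [avg, norm_smul, norm_inv, Fintype.card_fin, Real.norm_of_nonneg hm0.le, sub_nonneg]
    exact mul_le_mul_of_nonneg_left (norm_sum_le _ _) (by positivity)
  have q1 := mul_nonneg hX hR0
  have q2 := mul_le_mul_of_nonneg_left hRs (mul_nonneg hM₂ hD)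
  have q3 := mul_le_mul_of_nonneg_left p2 hM₁
  have q4 := mul_le_mul_of_nonneg_left p3 hM₂
  have e1 : M₁ * ‖avg X‖ * t ^ (1 - θ) * s ^ θ = M₁ * ‖avg X‖ * R := by rw [hR]; ring
  rw [hsplit, e1]
  nlinarith

/-- subcritical supersolution: if `α > -κ'(1)/log m`, then for `θ < 1` close
enough to `1` and `1 ≪ M₁ ≪ M₂`, the function
`G(x,y,z,t,s) = |y| t + M₁ |x| t^{1-θ} s^θ + M₂ (z - |x|) s` is a supersolution. -/
theorem statement2 (m ℓ : ℕ) (hm : 2 ≤ m) (hℓ : 1 ≤ ℓ)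
    (W : Submodule ℝ (Fin m → EuclideanSpace ℝ (Fin ℓ)))
    (hWV : ∀ w ∈ W, ∑ j, w j = 0)
    (φ : (Fin m → EuclideanSpace ℝ (Fin ℓ)) →ₗ[ℝ] (Fin m → ℝ))
    (hφV : ∀ w ∈ W, ∑ j, φ w j = 0)
    (α : ℝ) (hα : α ∈ Set.Ioo (0 : ℝ) 1)
    (hα' : -(kprime1 (W : Set (Fin m → EuclideanSpace ℝ (Fin ℓ)))) / Real.log m < α) :
    ∃ θ₀ ∈ Set.Ioo (0 : ℝ) 1, ∀ θ ∈ Set.Ioo θ₀ 1,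
      ∃ M₁₀ : ℝ, 1 ≤ M₁₀ ∧ ∀ M₁ : ℝ, M₁₀ ≤ M₁ →
        ∃ M₂₀ : ℝ, ∀ M₂ : ℝ, M₂₀ ≤ M₂ →
          Supersolution (W : Set (Fin m → EuclideanSpace ℝ (Fin ℓ))) (fun w => φ w) α
            (fun x y z t s =>
              |y| * t + M₁ * ‖x‖ * t ^ (1 - θ) * s ^ θ + M₂ * (z - ‖x‖) * s) := by
  have hm0 : (0 : ℝ) < m := by exact_mod_cast (by omega : 0 < m)
  obtain ⟨θ₀, hθ₀, hc⟩ := core1 m ℓ hm W α hα'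
  refine ⟨θ₀, hθ₀, fun θ hθ => ?_⟩
  obtain ⟨c, hc1, hc⟩ := hc θ hθ
  have hθ0 : 0 < θ := hθ₀.1.trans hθ.1
  -- the linear projection
  let P : (Fin m → EuclideanSpace ℝ (Fin ℓ)) →ₗ[ℝ] (Fin m → EuclideanSpace ℝ (Fin ℓ)) :=
    { toFun := fun X j => X j - avg X
      map_add' := fun X Y => by
        funext j
        simp only [avg, Pi.add_apply, Finset.sum_add_distrib, smul_add]
        abel
      map_smul' := fun r X => by
        funext j
        simp only [avg, Pi.smul_apply, ← Finset.smul_sum, RingHom.id_apply, smul_sub]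
        rw [smul_comm] }
  have hPX : ∀ X, P X = fun j => X j - avg X := fun X => rfl
  let Φ := LinearMap.toContinuousLinearMap φ
  have hΦ : ∀ w, Φ w = φ w := fun w => rfl
  have hcφ : Continuous φ := φ.continuous_of_finiteDimensional
  have hcP : Continuous P := P.continuous_of_finiteDimensional
  have hca : Continuous (fun X : Fin m → EuclideanSpace ℝ (Fin ℓ) => avg X) := by
    unfold avg; fun_prop
  let K : ℝ := (m : ℝ) ^ (-α) * (m * (‖Φ‖ * m))
  have hK0 : 0 ≤ K := by positivity
  have hc0 : 0 < 1 - c := by linarith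
  refine ⟨(K + 1) / (1 - c) + 1, by
    have : 0 ≤ (K + 1) / (1 - c) := by positivity
    linarith, fun M₁ hM₁ => ?_⟩
  have hM₁K : K < M₁ * (1 - c) := by
    have : (K + 1) / (1 - c) ≤ M₁ := by linarith
    rw [div_le_iff₀ hc0] at this
    linarith
  have hM₁0 : 0 ≤ M₁ := by
    have : 0 ≤ (K + 1) / (1 - c) := by positivity
    linarith
  have havs : ∀ (r : ℝ) (X : Fin m → EuclideanSpace ℝ (Fin ℓ)), avg (r • X) = r • avg X := by
    intro r X
    simp only [avg, Pi.smul_apply, ← Finset.smul_sum]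
    rw [smul_comm]
  obtain ⟨M₀, hM₀⟩ := core2 (W.comap P)
    (fun X => M₁ * ‖avg X‖ - (m : ℝ) ^ (-α) * ∑ j, |φ (P X) j|
        - M₁ * ((m : ℝ) ^ (-(α * (1 - θ))) * ((m : ℝ)⁻¹ * ∑ j, ‖X j‖ ^ (1 / θ)) ^ θ))
    (fun X => (m : ℝ)⁻¹ * ∑ j, ‖X j‖ - ‖avg X‖)
    (by
      have h1 : Continuous fun X : Fin m → EuclideanSpace ℝ (Fin ℓ) =>
          ((m : ℝ)⁻¹ * ∑ j, ‖X j‖ ^ (1 / θ)) ^ θ := by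
        apply Continuous.rpow_const _ (fun _ => Or.inr hθ0.le)
        apply continuous_const.mul
        apply continuous_finsetSum
        intro j _
        exact (continuous_apply j).norm.rpow_const (fun _ => Or.inr (by positivity))
      have h2 : Continuous fun X : Fin m → EuclideanSpace ℝ (Fin ℓ) => ∑ j, |φ (P X) j| := by
        apply continuous_finsetSum
        intro j _
        exact ((continuous_apply j).comp (hcφ.comp hcP)).abs
      exact ((continuous_const.mul hca.norm).sub (continuous_const.mul h2)).sub
        (continuous_const.mul (continuous_const.mul h1)))
    (by
      apply Continuous.sub _ hca.norm
      fun_prop)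
    (by
      intro r X hr
      have h1 : ∑ j, ‖(r • X) j‖ ^ (1 / θ) = r ^ (1 / θ) * ∑ j, ‖X j‖ ^ (1 / θ) := by
        rw [Finset.mul_sum]
        refine Finset.sum_congr rfl fun j _ => ?_
        rw [Pi.smul_apply, norm_smul, Real.norm_of_nonneg hr, Real.mul_rpow hr (norm_nonneg _)]
      have hP : 0 ≤ ∑ j, ‖X j‖ ^ (1 / θ) := Finset.sum_nonneg fun j _ => by positivity
      have h2 : ((m : ℝ)⁻¹ * (r ^ (1 / θ) * ∑ j, ‖X j‖ ^ (1 / θ))) ^ θ =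
          r * ((m : ℝ)⁻¹ * ∑ j, ‖X j‖ ^ (1 / θ)) ^ θ := by
        rw [mul_left_comm, Real.mul_rpow (by positivity) (by positivity), ← Real.rpow_mul hr,
          one_div_mul_cancel hθ0.ne', Real.rpow_one]
      have h3 : ∑ j, |φ (P (r • X)) j| = r * ∑ j, |φ (P X) j| := by
        rw [Finset.mul_sum]
        refine Finset.sum_congr rfl fun j _ => ?_
        rw [map_smul, map_smul, Pi.smul_apply, smul_eq_mul, abs_mul, abs_of_nonneg hr]
      simp only [h1, h2, h3, havs, norm_smul, Real.norm_of_nonneg hr]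
      ring)
    (by
      intro r X hr
      simp only [havs, norm_smul, Real.norm_of_nonneg hr, Pi.smul_apply, ← Finset.mul_sum]
      ring)
    (by
      intro X
      simp only [avg]
      rw [norm_smul, norm_inv, Fintype.card_fin, Real.norm_of_nonneg hm0.le, sub_nonneg]
      exact mul_le_mul_of_nonneg_left (norm_sum_le _ _) (by positivity))
    (by
      intro X hXW hX0 hXD
      obtain ⟨hpos, hcol⟩ := collinear hm X hXD hX0
      set n := ‖avg X‖ with hn
      have hXW' : P X ∈ W := hXW
      let v : Fin m → ℝ := fun j => ‖X j‖ / n - 1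
      have hPv : P X = fun j => v j • avg X := by
        rw [hPX]
        funext j
        simp only [v, sub_smul, one_smul, ← hcol j]
      have hv0 : ∑ j, v j = 0 := by
        simp only [v, Finset.sum_sub_distrib, ← Finset.sum_div]
        have : ∑ j, ‖X j‖ = m * n := by field_simp at hXD; linarith
        rw [this]
        field_simp
        simp
      have hv1 : ∀ j, -1 ≤ v j := fun j => by
        have : 0 ≤ ‖X j‖ / n := by positivity
        simp only [v]; linarith
      have hv : v ∈ MW (W : Set (Fin m → EuclideanSpace ℝ (Fin ℓ))) :=
        ⟨hv0, hv1, avg X, norm_pos_iff.1 hpos, by rw [← hPv]; exact hXW'⟩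
      have hcv := hc v hv
      have hXj : ∀ j, ‖X j‖ = n * (1 + v j) := fun j => by
        simp only [v]; field_simp; ring
      have h1 : ((m : ℝ)⁻¹ * ∑ j, ‖X j‖ ^ (1 / θ)) ^ θ =
          n * ((m : ℝ)⁻¹ * ∑ j, (1 + v j) ^ (1 / θ)) ^ θ := by
        have hv1' : ∀ j, 0 ≤ 1 + v j := fun j => by linarith [hv1 j]
        have hP : 0 ≤ ∑ j, (1 + v j) ^ (1 / θ) :=
          Finset.sum_nonneg fun j _ => Real.rpow_nonneg (hv1' j) _
        simp only [hXj, Real.mul_rpow hpos.le (hv1' _)]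
        rw [← Finset.mul_sum, mul_left_comm, Real.mul_rpow (by positivity) (by positivity),
          ← Real.rpow_mul hpos.le, one_div_mul_cancel hθ0.ne', Real.rpow_one]
      have h2 : (m : ℝ) ^ (-α) * ∑ j, |φ (P X) j| ≤ K * n := by
        have hPn : ‖P X‖ ≤ m * n := by
          rw [pi_norm_le_iff_of_nonneg (by positivity)]
          intro j
          rw [hPv]
          simp only [norm_smul, Real.norm_eq_abs]
          have h3 := v_le hv0 hv1 j
          have h4 := hv1 j
          have hm1 : (1 : ℝ) ≤ m := by exact_mod_cast (by omega : 1 ≤ m)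
          have : |v j| ≤ m := abs_le.2 ⟨by linarith, by linarith⟩
          exact mul_le_mul_of_nonneg_right this hpos.le
        have h5 : ∀ j, |φ (P X) j| ≤ ‖Φ‖ * (m * n) := fun j => by
          calc |φ (P X) j| ≤ ‖Φ (P X)‖ := norm_le_pi_norm (Φ (P X)) j
            _ ≤ ‖Φ‖ * ‖P X‖ := Φ.le_opNorm _
            _ ≤ _ := by gcongr
        have h6 : ∑ j, |φ (P X) j| ≤ m * (‖Φ‖ * (m * n)) := by
          refine (Finset.sum_le_sum fun j _ => h5 j).trans (le_of_eq ?_)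
          simp
        calc _ ≤ (m : ℝ) ^ (-α) * (m * (‖Φ‖ * (m * n))) := by gcongr
          _ = K * n := by simp only [K]; ring
      simp only [h1]
      have h7 := mul_le_mul_of_nonneg_left hcv (mul_nonneg hM₁0 hpos.le)
      have h8 := mul_lt_mul_of_pos_right hM₁K hpos
      nlinarith)
  refine ⟨max M₀ 0, fun M₂ hM₂ => ⟨?_, ?_⟩⟩
  · refine reduction m ℓ hm W φ α θ M₁ M₂ hα ⟨hθ0, hθ.2⟩ hM₁0 ((le_max_right _ _).trans hM₂) ?_
    intro X hX
    exact hM₀ M₂ ((le_max_left _ _).trans hM₂) X hX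
  · intro x y t s ht hts
    have hs : 0 ≤ s := ht.trans hts
    simp only [sub_self, mul_zero, zero_mul, add_zero]
    have : 0 ≤ M₁ * ‖x‖ * t ^ (1 - θ) * s ^ θ := by positivity
    linarith

end TracePaper
end
end
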